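/- arXiv:1612.09179 — 2 statements merged into one kernel-verified Lean document; each statement's English description precedes it below -/
import Mathlib

section
/- There exist a homeomorphism φ : 𝕋² → 𝕋² homotopic to the identity map of 𝕋² and a nonempty closed set Y ⊆ 𝕋² with φ(Y) = Y such that the restriction φ|_Y : Y → Y is a minimal homeomorphism of Y, while Y × Y admits no minimal homeomorphism. -/
open Function Set Topology Filter Metric

/-- A continuous map is minimal if every forward orbit `{f^n x : n ≥ 1}` is dense. -/
def IsMinimalMap {X : Type*} [TopologicalSpace X] (f : X → X) : Prop :=
  Continuous f ∧ ∀ x : X, Dense (Set.range fun n : ℕ => f^[n + 1] x)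

/-- A space admits a minimal homeomorphism. -/
def AdmitsMinimalHomeo (X : Type*) [TopologicalSpace X] : Prop :=
  ∃ h : X ≃ₜ X, IsMinimalMap (h : X → X)

/-- Factor map between dynamical systems. -/
def IsFactorMap {X Y : Type*} [TopologicalSpace X] [TopologicalSpace Y]
    (π : X → Y) (f : X → X) (g : Y → Y) : Prop :=
  Continuous π ∧ Function.Surjective π ∧ π ∘ f = g ∘ π

/-- A map is almost 1-1 if the set of points with singleton fiber is dense. -/
def IsAlmostOneOne {X Y : Type*} [TopologicalSpace X] [TopologicalSpace Y] (π : X → Y) : Prop :=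
  Dense {y : Y | ∃! x : X, π x = y}

/-! ### Automorphisms of the directed grid -/

/-- The reflexive relation on `ℤ × ℤ` joining `u` to the four corners of the unit square whose
lower left corner is `u`. -/
def GridStep (u v : ℤ × ℤ) : Prop :=
  (v.1 = u.1 ∨ v.1 = u.1 + 1) ∧ (v.2 = u.2 ∨ v.2 = u.2 + 1)

theorem gridStep_unit_iff (u v : ℤ × ℤ) :
    (GridStep u v ∧ u ≠ v ∧ ∀ d, GridStep u d → GridStep d v → d = u ∨ d = v) ↔
      v = (u.1 + 1, u.2) ∨ v = (u.1, u.2 + 1) := by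
  obtain ⟨a, b⟩ := u
  obtain ⟨c, d⟩ := v
  simp only [GridStep, Prod.forall, Prod.mk.injEq, ne_eq]
  constructor
  · rintro ⟨⟨h1, h2⟩, h3, h4⟩
    have := h4 (a + 1) b
    grind
  · rintro h
    refine ⟨by omega, by omega, ?_⟩
    intro x y
    omega

theorem gridStep_automorphism {g : ℤ × ℤ → ℤ × ℤ} (inj : Injective g) (surj : Surjective g)
    (hg : ∀ u v, GridStep (g u) (g v) ↔ GridStep u v) :
    ∃ i j : ℤ, (∀ n m, g (n, m) = (n + i, m + j)) ∨ (∀ n m, g (n, m) = (m + i, n + j)) := by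
  have unit : ∀ u v : ℤ × ℤ, (v = (u.1 + 1, u.2) ∨ v = (u.1, u.2 + 1)) →
      (g v = ((g u).1 + 1, (g u).2) ∨ g v = ((g u).1, (g u).2 + 1)) := by
    intro u v h
    rw [← gridStep_unit_iff] at h ⊢
    refine ⟨(hg _ _).2 h.1, fun e => h.2.1 (inj e), fun d h1 h2 => ?_⟩
    obtain ⟨d, rfl⟩ := surj d
    rw [hg] at h1 h2
    rcases h.2.2 d h1 h2 with rfl | rfl <;> simp
  have right : ∀ n m, g (n + 1, m) = ((g (n, m)).1 + 1, (g (n, m)).2) ∨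
      g (n + 1, m) = ((g (n, m)).1, (g (n, m)).2 + 1) := fun n m => unit (n, m) _ (Or.inl rfl)
  have up : ∀ n m, g (n, m + 1) = ((g (n, m)).1 + 1, (g (n, m)).2) ∨
      g (n, m + 1) = ((g (n, m)).1, (g (n, m)).2 + 1) := fun n m => unit (n, m) _ (Or.inr rfl)
  have ne : ∀ n m, g (n + 1, m) ≠ g (n, m + 1) := fun n m e => by
    have := inj e
    simp at this
  have ne2 : ∀ n m, g (n + 1, m + 1) ≠ g (n, m) := fun n m e => by
    have := inj e
    simp at this
  set T : ℤ → ℤ → Prop := fun n m => g (n + 1, m) = ((g (n, m)).1 + 1, (g (n, m)).2) with hT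
  have key : ∀ n m, (T n m ↔ T (n + 1) m) ∧ (T n m ↔ T n (m + 1)) := by
    intro n m
    have h1 := right n m
    have h2 := up n m
    have h3 := ne n m
    have h4 := up (n + 1) m
    have h5 := right n (m + 1)
    have h6 := right (n + 1) m
    have h7 := ne (n + 1) m
    simp only [hT]
    generalize g (n + 1 + 1, m) = x1 at *
    generalize g (n + 1, m + 1) = x2 at *
    generalize g (n, m + 1) = x3 at *
    generalize g (n + 1, m) = x4 at *
    generalize g (n, m) = x5 at *
    simp only [Prod.ext_iff, ne_eq] at *
    constructor <;> omega
  have hall : ∀ n m, T n m ↔ T 0 0 := by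
    have h1 : ∀ n m, T n m ↔ T 0 m := by
      intro n m
      induction n using Int.induction_on with
      | zero => rfl
      | succ k ih => rw [← (key _ _).1, ih]
      | pred k ih =>
        rw [← ih]
        have := (key (-(k : ℤ) - 1) m).1
        simpa using this
    intro n m
    rw [h1]
    induction m using Int.induction_on with
    | zero => rfl
    | succ k ih => rw [← (key _ _).2, ih]
    | pred k ih =>
      rw [← ih]
      have := (key 0 (-(k : ℤ) - 1)).2
      simpa using this
  refine ⟨(g (0, 0)).1, (g (0, 0)).2, ?_⟩
  by_cases h0 : T 0 0
  · left
    have hr : ∀ n m, g (n + 1, m) = ((g (n, m)).1 + 1, (g (n, m)).2) := fun n m =>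
      (hall n m).2 h0
    have hu : ∀ n m, g (n, m + 1) = ((g (n, m)).1, (g (n, m)).2 + 1) := fun n m => by
      rcases up n m with h | h
      · exact absurd ((hr n m).trans h.symm) (ne n m)
      · exact h
    have h1 : ∀ m, g (0, m) = ((g (0, 0)).1, m + (g (0, 0)).2) := by
      intro m
      induction m using Int.induction_on with
      | zero => simp
      | succ k ih =>
        rw [hu, ih]
        simp only [Prod.mk.injEq]
        constructor <;> push_cast
        ring
      | pred k ih =>
        have := hu 0 (-(k : ℤ) - 1)
        rw [sub_add_cancel, ih] at this
        simp only [Prod.ext_iff] at this ⊢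
        constructor <;> omega
    intro n m
    induction n using Int.induction_on with
    | zero => rw [h1]; simp
    | succ k ih =>
      rw [hr, ih]
      simp only [Prod.mk.injEq]
      constructor <;> push_cast
      ring
    | pred k ih =>
      have := hr (-(k : ℤ) - 1) m
      rw [sub_add_cancel, ih] at this
      simp only [Prod.ext_iff] at this ⊢
      constructor <;> omega
  · right
    have hr : ∀ n m, g (n + 1, m) = ((g (n, m)).1, (g (n, m)).2 + 1) := fun n m =>
      (right n m).resolve_left fun h => h0 ((hall n m).1 h)
    have hu : ∀ n m, g (n, m + 1) = ((g (n, m)).1 + 1, (g (n, m)).2) := fun n m => by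
      rcases up n m with h | h
      · exact h
      · exact absurd ((hr n m).trans h.symm) (ne n m)
    have h1 : ∀ m, g (0, m) = (m + (g (0, 0)).1, (g (0, 0)).2) := by
      intro m
      induction m using Int.induction_on with
      | zero => simp
      | succ k ih =>
        rw [hu, ih]
        simp only [Prod.mk.injEq]
        constructor <;> push_cast
        ring
      | pred k ih =>
        have := hu 0 (-(k : ℤ) - 1)
        rw [sub_add_cancel, ih] at this
        simp only [Prod.ext_iff] at this ⊢
        constructor <;> omega
    intro n m
    induction n using Int.induction_on with
    | zero => rw [h1]; simp
    | succ k ih =>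
      rw [hr, ih]
      simp only [Prod.mk.injEq]
      constructor <;> push_cast
      ring
    | pred k ih =>
      have := hr (-(k : ℤ) - 1) m
      rw [sub_add_cancel, ih] at this
      simp only [Prod.ext_iff] at this ⊢
      constructor <;> omega

/-! ### Adherence of path components -/

/-- The closure of the path component of `x` meets the path component of `y`. -/
def PathAdherent {X : Type*} [TopologicalSpace X] (x y : X) : Prop :=
  (closure (pathComponent x) ∩ pathComponent y).Nonempty

/-- The closure of the path component of `x` meets only finitely many path components. -/
def FinitePathAdherence {X : Type*} [TopologicalSpace X] (x : X) : Prop :=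
  ∃ s : Set X, s.Finite ∧ ∀ y, PathAdherent x y → ∃ z ∈ s, Joined z y

theorem pathAdherent_refl {X : Type*} [TopologicalSpace X] (x : X) : PathAdherent x x :=
  ⟨x, subset_closure (mem_pathComponent_self x), mem_pathComponent_self x⟩

theorem pathAdherent_prod {X Y : Type*} [TopologicalSpace X] [TopologicalSpace Y]
    (x x' : X) (y y' : Y) :
    PathAdherent (x, y) (x', y') ↔ PathAdherent x x' ∧ PathAdherent y y' := by
  simp only [PathAdherent, pathComponent_prod, closure_prod_eq, Set.prod_inter_prod,
    Set.prod_nonempty_iff]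

theorem finitePathAdherence_prod {X Y : Type*} [TopologicalSpace X] [TopologicalSpace Y]
    (x : X) (y : Y) :
    FinitePathAdherence (x, y) ↔ FinitePathAdherence x ∧ FinitePathAdherence y := by
  constructor
  · rintro ⟨s, hs, h⟩
    refine ⟨⟨Prod.fst '' s, hs.image _, fun x' hx' => ?_⟩,
      ⟨Prod.snd '' s, hs.image _, fun y' hy' => ?_⟩⟩
    · obtain ⟨z, hz, hj⟩ := h (x', y) ((pathAdherent_prod _ _ _ _).2 ⟨hx', pathAdherent_refl y⟩)
      exact ⟨z.1, mem_image_of_mem _ hz, hj.map continuous_fst⟩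
    · obtain ⟨z, hz, hj⟩ := h (x, y') ((pathAdherent_prod _ _ _ _).2 ⟨pathAdherent_refl x, hy'⟩)
      exact ⟨z.2, mem_image_of_mem _ hz, hj.map continuous_snd⟩
  · rintro ⟨⟨s, hs, h⟩, ⟨t, ht, h'⟩⟩
    refine ⟨s ×ˢ t, hs.prod ht, ?_⟩
    rintro ⟨x', y'⟩ hxy
    rw [pathAdherent_prod] at hxy
    obtain ⟨z, hz, hj⟩ := h x' hxy.1
    obtain ⟨w, hw, hk⟩ := h' y' hxy.2
    exact ⟨(z, w), ⟨hz, hw⟩, hj.prod hk⟩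

section Homeomorph

variable {X : Type*} [TopologicalSpace X]

theorem joined_homeomorph_iff (h : X ≃ₜ X) (x y : X) : Joined (h x) (h y) ↔ Joined x y :=
  ⟨fun H => by simpa using H.map h.symm.continuous, fun H => H.map h.continuous⟩

theorem image_pathComponent (h : X ≃ₜ X) (x : X) :
    h '' pathComponent x = pathComponent (h x) := by
  ext y
  rw [← h.apply_symm_apply y, h.injective.mem_set_image, mem_pathComponent_iff,
    mem_pathComponent_iff, joined_homeomorph_iff]

theorem pathAdherent_homeomorph_iff (h : X ≃ₜ X) (x y : X) :
    PathAdherent (h x) (h y) ↔ PathAdherent x y := by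
  rw [PathAdherent, ← image_pathComponent, ← image_pathComponent, ← h.image_closure,
    ← image_inter h.injective, image_nonempty, PathAdherent]

theorem FinitePathAdherence.homeomorph {x : X} (H : FinitePathAdherence x) (h : X ≃ₜ X) :
    FinitePathAdherence (h x) := by
  obtain ⟨s, hs, H⟩ := H
  refine ⟨h '' s, hs.image _, fun y hy => ?_⟩
  rw [← h.apply_symm_apply y, pathAdherent_homeomorph_iff] at hy
  obtain ⟨z, hz, hj⟩ := H _ hy
  refine ⟨h z, mem_image_of_mem _ hz, ?_⟩
  simpa using hj.map h.continuous

end Homeomorph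

/-! ### Spaces with a chain of path components -/

/-- A bi-infinite chain of path components `P n`, each accumulating exactly on itself and its
successor, all other path components being dense; the continuous function `χ` to the circle
records the place along the chain where `P n` accumulates on `P (n + 1)`. -/
structure PathChain (X : Type*) [TopologicalSpace X] (P : ℤ → Set X)
    (χ : X → AddCircle (1 : ℝ)) (c : ℝ) : Prop where
  nonempty : ∀ n, (P n).Nonempty
  joined_iff : ∀ n x y, x ∈ P n → (Joined x y ↔ y ∈ P n)
  disjoint : ∀ n m x, x ∈ P n → x ∈ P m → n = m
  closure_subset : ∀ n, closure (P n) ⊆ P n ∪ P (n + 1)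
  closure_meets : ∀ n, (closure (P n) ∩ P (n + 1)).Nonempty
  dense : ∀ x, (∀ n, x ∉ P n) → Dense (pathComponent x)
  continuous : Continuous χ
  surjective : Surjective χ
  apply_eq : ∀ n x, x ∈ closure (P n) → x ∈ P (n + 1) →
    χ x = ((((n + 1 : ℤ) : ℝ) * c : ℝ) : AddCircle (1 : ℝ))

namespace PathChain

variable {X : Type*} [TopologicalSpace X] {P : ℤ → Set X} {χ : X → AddCircle (1 : ℝ)} {c : ℝ}

theorem pathComponent_eq (H : PathChain X P χ c) {n : ℤ} {x : X} (hx : x ∈ P n) :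
    pathComponent x = P n := by
  ext y
  rw [mem_pathComponent_iff, H.joined_iff n x y hx]

theorem pathAdherent_iff (H : PathChain X P χ c) {n m : ℤ} {x y : X} (hx : x ∈ P n)
    (hy : y ∈ P m) : PathAdherent x y ↔ m = n ∨ m = n + 1 := by
  rw [PathAdherent, H.pathComponent_eq hx, H.pathComponent_eq hy]
  constructor
  · rintro ⟨z, hz, hzm⟩
    rcases H.closure_subset n hz with h | h
    · exact Or.inl (H.disjoint _ _ _ hzm h)
    · exact Or.inr (H.disjoint _ _ _ hzm h)
  · rintro (rfl | rfl)
    · exact ⟨x, subset_closure hx, hx⟩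
    · exact H.closure_meets n

theorem finitePathAdherence_iff (H : PathChain X P χ c) (x : X) :
    FinitePathAdherence x ↔ ∃ n, x ∈ P n := by
  constructor
  · rintro ⟨s, hs, h⟩
    by_contra! hx
    choose e he using H.nonempty
    have : ∀ n, ∃ z ∈ s, Joined z (e n) := fun n =>
      h _ ⟨e n, H.dense x hx _, mem_pathComponent_self _⟩
    choose f hf hj using this
    have finj : Injective f := fun n m hnm => by
      have := (hj n).symm.trans (hnm ▸ hj m)
      rw [H.joined_iff n _ _ (he n)] at this
      exact H.disjoint _ _ _ this (he m)
    exact Set.infinite_of_injective_forall_mem finj hf hs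
  · rintro ⟨n, hx⟩
    choose e he using H.nonempty
    refine ⟨{e n, e (n + 1)}, by simp, ?_⟩
    rintro y ⟨z, hz, hzy⟩
    rw [H.pathComponent_eq hx] at hz
    rcases H.closure_subset n hz with h | h
    · exact ⟨e n, by simp, ((H.joined_iff n _ _ (he n)).2 h).trans hzy.symm⟩
    · exact ⟨e (n + 1), by simp, ((H.joined_iff (n + 1) _ _ (he (n + 1))).2 h).trans hzy.symm⟩

/-- A homeomorphism of the square of a chain acts on the grid of products of links. -/
theorem exists_grid_map (H : PathChain X P χ c) (h : X × X ≃ₜ X × X) :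
    ∃ g : ℤ × ℤ → ℤ × ℤ, (∀ u x, x.1 ∈ P u.1 → x.2 ∈ P u.2 →
      (h x).1 ∈ P (g u).1 ∧ (h x).2 ∈ P (g u).2) := by
  choose e he using H.nonempty
  have ex : ∀ u : ℤ × ℤ, ∃ v : ℤ × ℤ,
      (h (e u.1, e u.2)).1 ∈ P v.1 ∧ (h (e u.1, e u.2)).2 ∈ P v.2 := fun u => by
    have : FinitePathAdherence (e u.1, e u.2) := (finitePathAdherence_prod _ _).2
      ⟨(H.finitePathAdherence_iff _).2 ⟨_, he _⟩, (H.finitePathAdherence_iff _).2 ⟨_, he _⟩⟩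
    obtain ⟨h1, h2⟩ := (finitePathAdherence_prod _ _).1 (this.homeomorph h)
    obtain ⟨n, hn⟩ := (H.finitePathAdherence_iff _).1 h1
    obtain ⟨m, hm⟩ := (H.finitePathAdherence_iff _).1 h2
    exact ⟨(n, m), hn, hm⟩
  choose g hg1 hg2 using ex
  refine ⟨g, fun u x hx1 hx2 => ?_⟩
  have hj : Joined (h (e u.1, e u.2)) (h x) :=
    (((H.joined_iff _ _ _ (he _)).2 hx1).prod ((H.joined_iff _ _ _ (he _)).2 hx2)).map h.continuous
  exact ⟨(H.joined_iff _ _ _ (hg1 u)).1 (hj.map continuous_fst),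
    (H.joined_iff _ _ _ (hg2 u)).1 (hj.map continuous_snd)⟩

theorem exists_grid_affine (H : PathChain X P χ c) (h : X × X ≃ₜ X × X) :
    ∃ g : ℤ × ℤ → ℤ × ℤ, (∀ u x, x.1 ∈ P u.1 → x.2 ∈ P u.2 →
      (h x).1 ∈ P (g u).1 ∧ (h x).2 ∈ P (g u).2) ∧
      ∃ i j : ℤ, (∀ n m, g (n, m) = (n + i, m + j)) ∨ (∀ n m, g (n, m) = (m + i, n + j)) := by
  choose e he using H.nonempty
  obtain ⟨g, hg⟩ := H.exists_grid_map h
  obtain ⟨k, hk⟩ := H.exists_grid_map h.symm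
  have uniq : ∀ (u v : ℤ × ℤ) (x : X × X), x.1 ∈ P u.1 → x.2 ∈ P u.2 → x.1 ∈ P v.1 →
      x.2 ∈ P v.2 → u = v := fun u v x h1 h2 h3 h4 =>
    Prod.ext (H.disjoint _ _ _ h1 h3) (H.disjoint _ _ _ h2 h4)
  have kg : LeftInverse k g := fun u => by
    obtain ⟨h1, h2⟩ := hg u (e u.1, e u.2) (he _) (he _)
    obtain ⟨h3, h4⟩ := hk _ _ h1 h2
    simp only [Homeomorph.symm_apply_apply] at h3 h4
    exact uniq _ _ (e u.1, e u.2) h3 h4 (he _) (he _)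
  have gk : RightInverse k g := fun u => by
    obtain ⟨h1, h2⟩ := hk u (e u.1, e u.2) (he _) (he _)
    obtain ⟨h3, h4⟩ := hg _ _ h1 h2
    simp only [Homeomorph.apply_symm_apply] at h3 h4
    exact uniq _ _ (e u.1, e u.2) h3 h4 (he _) (he _)
  refine ⟨g, hg, gridStep_automorphism kg.injective gk.surjective fun u v => ?_⟩
  have step : ∀ (u v : ℤ × ℤ) (x y : X × X), x.1 ∈ P u.1 → x.2 ∈ P u.2 → y.1 ∈ P v.1 →
      y.2 ∈ P v.2 → (PathAdherent x y ↔ GridStep u v) := by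
    rintro u v ⟨x1, x2⟩ ⟨y1, y2⟩ h1 h2 h3 h4
    rw [pathAdherent_prod, H.pathAdherent_iff h1 h3, H.pathAdherent_iff h2 h4, GridStep]
  obtain ⟨h1, h2⟩ := hg u (e u.1, e u.2) (he _) (he _)
  obtain ⟨h3, h4⟩ := hg v (e v.1, e v.2) (he _) (he _)
  rw [← step _ _ _ _ h1 h2 h3 h4, pathAdherent_homeomorph_iff,
    step u v _ _ (he _) (he _) (he _) (he _)]

/-- The part of `P n` on which `P (n - 1)` accumulates. -/
def joint (P : ℤ → Set X) (n : ℤ) : Set X := closure (P (n - 1)) ∩ P n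

theorem exists_joint_map (H : PathChain X P χ c) (h : X × X ≃ₜ X × X) :
    ∃ g : ℤ × ℤ → ℤ × ℤ,
      (∀ u, ∀ x ∈ joint P u.1 ×ˢ joint P u.2, h x ∈ joint P (g u).1 ×ˢ joint P (g u).2) ∧
      ∃ i j : ℤ, (∀ n m, g (n, m) = (n + i, m + j)) ∨ (∀ n m, g (n, m) = (m + i, n + j)) := by
  obtain ⟨g, hg, i, j, hij⟩ := H.exists_grid_affine h
  refine ⟨g, ?_, i, j, hij⟩
  rintro ⟨n, m⟩ x ⟨⟨h1, h2⟩, ⟨h3, h4⟩⟩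
  have hprev : g (n - 1, m - 1) = ((g (n, m)).1 - 1, (g (n, m)).2 - 1) := by
    rcases hij with hij | hij <;> rw [hij, hij] <;> ext <;> simp <;> ring
  have hcl : x ∈ closure (P (n - 1) ×ˢ P (m - 1)) := by
    rw [closure_prod_eq]
    exact ⟨h1, h3⟩
  have hmaps : MapsTo h (P (n - 1) ×ˢ P (m - 1))
      (P ((g (n, m)).1 - 1) ×ˢ P ((g (n, m)).2 - 1)) := fun y hy => by
    have := hg (n - 1, m - 1) y hy.1 hy.2
    rwa [hprev] at this
  have := map_mem_closure h.continuous hcl hmaps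
  rw [closure_prod_eq] at this
  have h5 := hg (n, m) x h2 h4
  exact ⟨⟨this.1, h5.1⟩, ⟨this.2, h5.2⟩⟩

theorem apply_joint (H : PathChain X P χ c) {n : ℤ} {x : X} (hx : x ∈ joint P n) :
    χ x = n • (c : AddCircle (1 : ℝ)) := by
  have h := H.apply_eq (n - 1) x hx.1 (by rw [sub_add_cancel]; exact hx.2)
  rw [h, sub_add_cancel, ← AddCircle.coe_zsmul, zsmul_eq_mul]

theorem _root_.AddCircle.coe_ne_zero_of_lt_one {r : ℝ} (h0 : 0 < r) (h1 : r < 1) :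
    (r : AddCircle (1 : ℝ)) ≠ 0 := by
  rw [Ne, AddCircle.coe_eq_zero_iff]
  rintro ⟨n, hn⟩
  rw [zsmul_eq_mul, mul_one] at hn
  rw [← hn] at h0 h1
  norm_cast at h0 h1
  omega

theorem _root_.AddCircle.eq_zero_of_forall_zsmul {j : ℤ}
    (h : ∀ a : AddCircle (1 : ℝ), j • a = 0) : j = 0 := by
  by_contra hj
  have h1 := h ((1 / (2 * j) : ℝ) : AddCircle (1 : ℝ))
  rw [← AddCircle.coe_zsmul, zsmul_eq_mul] at h1
  have hj' : (j : ℝ) ≠ 0 := by exact_mod_cast hj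
  rw [show (j : ℝ) * (1 / (2 * j)) = 1 / 2 by field_simp] at h1
  exact AddCircle.coe_ne_zero_of_lt_one (by norm_num) (by norm_num) h1

theorem not_minimalHomeo_prod (H : PathChain X P χ c) : ¬ AdmitsMinimalHomeo (X × X) := by
  rintro ⟨h, -, hd⟩
  obtain ⟨g, hg, i, j, hij⟩ := H.exists_joint_map h
  obtain ⟨p, hp⟩ : (joint P 0).Nonempty := by simpa [joint] using H.closure_meets (-1)
  have orbit : ∀ k : ℕ, h^[k] (p, p) ∈ joint P (g^[k] (0, 0)).1 ×ˢ joint P (g^[k] (0, 0)).2 := by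
    intro k
    induction k with
    | zero => exact ⟨hp, hp⟩
    | succ k ih =>
      rw [iterate_succ_apply', iterate_succ_apply']
      exact hg _ _ ih
  have full : ∀ C : Set (AddCircle (1 : ℝ) × AddCircle (1 : ℝ)), IsClosed C →
      (∀ k : ℕ, (((g^[k] (0, 0)).1 • (c : AddCircle (1 : ℝ)),
        (g^[k] (0, 0)).2 • (c : AddCircle (1 : ℝ))) : AddCircle (1 : ℝ) × AddCircle (1 : ℝ)) ∈ C) →
      ∀ a, a ∈ C := by
    rintro C hC hk ⟨a, b⟩
    obtain ⟨x, rfl⟩ := H.surjective a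
    obtain ⟨y, rfl⟩ := H.surjective b
    have hcont : Continuous (Prod.map χ χ) := H.continuous.prodMap H.continuous
    have : closure (range fun n : ℕ => h^[n + 1] (p, p)) ⊆ Prod.map χ χ ⁻¹' C := by
      refine closure_minimal ?_ (hC.preimage hcont)
      rintro _ ⟨n, rfl⟩
      have h1 := orbit (n + 1)
      have h2 := hk (n + 1)
      rw [← H.apply_joint h1.1, ← H.apply_joint h1.2] at h2
      exact h2
    exact this (hd (p, p) (x, y))
  rcases hij with hij | hij
  · have idx : ∀ k : ℕ, g^[k] (0, 0) = (k * i, k * j) := by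
      intro k
      induction k with
      | zero => simp
      | succ k ih => rw [iterate_succ_apply', ih, hij]; ext <;> push_cast <;> ring
    have h1 := full {a | j • a.1 = i • a.2}
      (isClosed_eq (by fun_prop) (by fun_prop)) fun k => by
        simp only [idx, mem_ofPred_eq, smul_smul]
        congr 1
        ring
    have hj : j = 0 := AddCircle.eq_zero_of_forall_zsmul fun a => by simpa using h1 (a, 0)
    have hi : i = 0 := AddCircle.eq_zero_of_forall_zsmul fun a => by simpa using (h1 (0, a)).symm
    have h2 := full {a | a.1 = 0} (isClosed_eq (by fun_prop) (by fun_prop)) fun k => by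
      simp [idx, hi]
    exact AddCircle.coe_ne_zero_of_lt_one (r := 1 / 2) (by norm_num) (by norm_num)
      (h2 (((1 / 2 : ℝ) : AddCircle (1 : ℝ)), 0))
  · have idx : ∀ k : ℕ, (g^[k] (0, 0)).1 - (g^[k] (0, 0)).2 ∈ ({0, i - j} : Set ℤ) := by
      intro k
      induction k with
      | zero => simp
      | succ k ih =>
        rw [iterate_succ_apply']
        generalize g^[k] (0, 0) = u at ih
        obtain ⟨n, m⟩ := u
        rw [hij]
        simp only [mem_insert_iff, mem_singleton_iff] at ih ⊢
        omega
    have h1 := full {a | a.1 - a.2 ∈ ({0, (i - j) • (c : AddCircle (1 : ℝ))} : Set _)}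
      ((Set.toFinite _).isClosed.preimage (by fun_prop)) fun k => by
        have hk := idx k
        simp only [mem_ofPred_eq, mem_insert_iff, mem_singleton_iff] at hk ⊢
        rw [← sub_smul]
        rcases hk with hk | hk <;> rw [hk] <;> simp
    have h2 := h1 (((1 / 2 : ℝ) : AddCircle (1 : ℝ)), 0)
    have h3 := h1 (((1 / 4 : ℝ) : AddCircle (1 : ℝ)), 0)
    simp only [sub_zero, mem_ofPred_eq, mem_insert_iff, mem_singleton_iff] at h2 h3
    have h4 := h2.resolve_left
      (AddCircle.coe_ne_zero_of_lt_one (by norm_num) (by norm_num))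
    have h5 := h3.resolve_left
      (AddCircle.coe_ne_zero_of_lt_one (by norm_num) (by norm_num))
    rw [← h5, ← sub_eq_zero, ← AddCircle.coe_sub] at h4
    exact AddCircle.coe_ne_zero_of_lt_one (by norm_num) (by norm_num) h4

end PathChain

/-! ### The transition profile -/

namespace Denjoy

open Int (fract floor)

/-- The height of the profile at phase `s ∈ [0, 1)`; it oscillates as `s → 1`. -/
noncomputable def wave (s : ℝ) : ℝ := s / 4 * (1 + Real.sin (1 / (1 - s)))

/-- The `c`-periodic height function. -/
noncomputable def height (c t : ℝ) : ℝ := wave (fract (t / c))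

/-- A ramp increasing in `u ∈ [0, 1)` from `0` to the height at `t`. -/
noncomputable def ramp (c t u : ℝ) : ℝ :=
  height c t * max 0 (1 - (1 - u) / (1 - fract (t / c)))

/-- The transition profile, with a jump at every integer value of `v`. -/
noncomputable def profile (c t v : ℝ) : ℝ := ramp c t (fract v) - fract v

/-- The left limit in `v` of the transition profile. -/
noncomputable def leftProfile (c t v : ℝ) : ℝ :=
  if fract v = 0 then height c t - 1 else profile c t v

theorem wave_nonneg {s : ℝ} (h : 0 ≤ s) : 0 ≤ wave s :=
  mul_nonneg (by linarith) (by linarith [Real.neg_one_le_sin (1 / (1 - s))])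

theorem wave_le {s : ℝ} (h : 0 ≤ s) : wave s ≤ s / 2 := by
  have : s / 4 * (1 + Real.sin (1 / (1 - s))) ≤ s / 4 * 2 :=
    mul_le_mul_of_nonneg_left (by linarith [Real.sin_le_one (1 / (1 - s))]) (by linarith)
  rw [wave]
  linarith

theorem continuousOn_wave : ContinuousOn wave (Iio 1) := by
  unfold wave
  intro s hs
  have : (1 - s) ≠ 0 := by
    have : s < 1 := hs
    linarith
  apply ContinuousAt.continuousWithinAt
  fun_prop (disch := exact this)

section

variable {c t u v : ℝ}

theorem height_nonneg : 0 ≤ height c t := wave_nonneg (Int.fract_nonneg _)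

theorem height_le_fract : height c t ≤ fract (t / c) := by
  have := wave_le (Int.fract_nonneg (t / c))
  have := Int.fract_nonneg (t / c)
  rw [height]
  linarith

theorem height_le_half : height c t ≤ 1 / 2 := by
  have := wave_le (Int.fract_nonneg (t / c))
  have := Int.fract_lt_one (t / c)
  rw [height]
  linarith

theorem fract_div_add_mul (hc : 0 < c) (n : ℤ) : fract ((t + n * c) / c) = fract (t / c) := by
  rw [add_div, mul_div_cancel_right₀ _ hc.ne', Int.fract_add_intCast]

theorem height_add_mul (hc : 0 < c) (n : ℤ) : height c (t + n * c) = height c t := by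
  rw [height, height, fract_div_add_mul hc n]

theorem ramp_nonneg : 0 ≤ ramp c t u := mul_nonneg height_nonneg (le_max_left _ _)

theorem ramp_le_height (hu : u ≤ 1) : ramp c t u ≤ height c t := by
  refine mul_le_of_le_one_right height_nonneg (max_le zero_le_one ?_)
  have : 0 ≤ (1 - u) / (1 - fract (t / c)) :=
    div_nonneg (by linarith) (by linarith [Int.fract_lt_one (t / c)])
  linarith

theorem ramp_eq_zero (h : u ≤ fract (t / c)) : ramp c t u = 0 := by
  have h1 : 0 < 1 - fract (t / c) := by linarith [Int.fract_lt_one (t / c)]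
  have : 1 ≤ (1 - u) / (1 - fract (t / c)) := by
    rw [one_le_div h1]
    linarith
  rw [ramp, max_eq_left (by linarith), mul_zero]

theorem ramp_le_self (h0 : 0 ≤ u) (hu : u ≤ 1) : ramp c t u ≤ u := by
  rcases le_total u (fract (t / c)) with h | h
  · rw [ramp_eq_zero h]
    exact h0
  · exact (ramp_le_height hu).trans (height_le_fract.trans h)

theorem ramp_le_fract_mul (hu : u < 1) :
    ramp c t u ≤ fract (t / c) * (1 - fract (t / c)) / (1 - u) := by
  have h1 : 0 < 1 - u := by linarith
  have h2 := Int.fract_nonneg (t / c)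
  have h3 := Int.fract_lt_one (t / c)
  rcases le_total u (fract (t / c)) with h | h
  · rw [ramp_eq_zero h]
    exact div_nonneg (mul_nonneg h2 (by linarith)) h1.le
  · rw [le_div_iff₀ h1]
    have := (ramp_le_height (c := c) (t := t) hu.le).trans height_le_fract
    have h5 : 0 ≤ ramp c t u := ramp_nonneg
    nlinarith

theorem ramp_mono : Monotone (ramp c t) := fun u u' h => by
  have : 0 < 1 - fract (t / c) := by linarith [Int.fract_lt_one (t / c)]
  unfold ramp
  have := height_nonneg (c := c) (t := t)
  gcongr

theorem ramp_add_mul (hc : 0 < c) (n : ℤ) : ramp c (t + n * c) u = ramp c t u := by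
  rw [ramp, ramp, fract_div_add_mul hc n, height_add_mul hc n]

theorem profile_add_mul (hc : 0 < c) (n : ℤ) : profile c (t + n * c) v = profile c t v := by
  rw [profile, profile, ramp_add_mul hc n]

theorem leftProfile_add_mul (hc : 0 < c) (n : ℤ) :
    leftProfile c (t + n * c) v = leftProfile c t v := by
  rw [leftProfile, leftProfile, profile_add_mul hc n, height_add_mul hc n]

theorem profile_add_int (m : ℤ) : profile c t (v + m) = profile c t v := by
  rw [profile, profile, Int.fract_add_intCast]

theorem leftProfile_add_int (m : ℤ) : leftProfile c t (v + m) = leftProfile c t v := by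
  rw [leftProfile, leftProfile, profile_add_int, Int.fract_add_intCast]

theorem profile_nonpos : profile c t v ≤ 0 := by
  have := ramp_le_self (c := c) (t := t) (Int.fract_nonneg v) (Int.fract_lt_one v).le
  rw [profile]
  linarith

theorem neg_fract_le_profile : -fract v ≤ profile c t v := by
  have := ramp_nonneg (c := c) (t := t) (u := fract v)
  rw [profile]
  linarith

theorem profile_eq_zero (h : fract v = 0) : profile c t v = 0 :=
  le_antisymm profile_nonpos (by simpa [h] using neg_fract_le_profile (c := c) (t := t) (v := v))

theorem leftProfile_of_ne (h : fract v ≠ 0) : leftProfile c t v = profile c t v := if_neg h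

theorem leftProfile_of_eq (h : fract v = 0) : leftProfile c t v = height c t - 1 := if_pos h

theorem leftProfile_le_profile : leftProfile c t v ≤ profile c t v := by
  by_cases h : fract v = 0
  · rw [leftProfile_of_eq h, profile_eq_zero h]
    linarith [height_le_half (c := c) (t := t)]
  · rw [leftProfile_of_ne h]

theorem neg_one_le_leftProfile : -1 ≤ leftProfile c t v := by
  by_cases h : fract v = 0
  · rw [leftProfile_of_eq h]
    linarith [height_nonneg (c := c) (t := t)]
  · rw [leftProfile_of_ne h]
    linarith [neg_fract_le_profile (c := c) (t := t) (v := v), Int.fract_lt_one v]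

theorem add_profile_le_add_leftProfile {v v' : ℝ} (h : v < v') :
    v + profile c t v ≤ v' + leftProfile c t v' := by
  have e : ∀ v, v + profile c t v = ⌊v⌋ + ramp c t (fract v) := fun v => by
    rw [profile]
    linarith [Int.floor_add_fract v]
  have hr := ramp_le_height (c := c) (t := t) (Int.fract_lt_one v).le
  rcases (Int.floor_mono h.le).lt_or_eq with hf | hf
  · have hf' : (⌊v⌋ : ℝ) + 1 ≤ ⌊v'⌋ := by exact_mod_cast hf
    by_cases h0 : fract v' = 0
    · rw [e, leftProfile_of_eq h0]
      linarith [Int.floor_add_fract v']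
    · rw [leftProfile_of_ne h0, e, e]
      linarith [ramp_nonneg (c := c) (t := t) (u := fract v'), height_le_half (c := c) (t := t)]
  · have hlt : fract v < fract v' := by
      rw [Int.fract, Int.fract, hf]
      linarith
    rw [leftProfile_of_ne ((Int.fract_nonneg v).trans_lt hlt).ne', e, e, hf]
    linarith [ramp_mono (c := c) (t := t) hlt.le]

end

theorem continuousAt_fract {v : ℝ} (h : fract v ≠ 0) : ContinuousAt (fract : ℝ → ℝ) v := by
  have h0 : (⌊v⌋ : ℝ) < v := by
    have := (Int.fract_nonneg v).lt_of_ne' h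
    have := Int.floor_add_fract v
    linarith
  have h1 := continuousOn_fract (α := ℝ) ⌊v⌋
  exact h1.continuousAt (Ico_mem_nhds h0 (Int.lt_floor_add_one v))

theorem continuous_fract_mul : Continuous fun t : ℝ => fract t * (1 - fract t) :=
  ContinuousOn.comp_fract'' (f := fun t : ℝ => t * (1 - t)) (by fun_prop) (by simp)

theorem continuousAt_height {c t : ℝ} (h : fract (t / c) ≠ 0) : ContinuousAt (height c) t := by
  have h1 : ContinuousAt (fun t : ℝ => fract (t / c)) t :=
    (continuousAt_fract h).comp (f := fun t : ℝ => t / c) (by fun_prop)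
  have h2 : ContinuousAt wave (fract (t / c)) :=
    continuousOn_wave.continuousAt (Iio_mem_nhds (Int.fract_lt_one _))
  exact ContinuousAt.comp (f := fun t : ℝ => fract (t / c)) h2 h1

theorem continuousOn_height {c : ℝ} (hc : 0 < c) (n : ℤ) :
    ContinuousOn (height c) (Ico (n * c) ((n + 1 : ℤ) * c)) := by
  have : ContinuousOn (fun t : ℝ => wave (t / c - n)) (Ico (n * c) ((n + 1 : ℤ) * c)) := by
    refine continuousOn_wave.comp (by fun_prop) fun t ht => ?_
    have := (div_lt_iff₀ hc).2 ht.2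
    push_cast at this
    simp only [mem_Iio]
    linarith
  refine this.congr fun t ht => ?_
  rw [height, Int.fract, Int.floor_eq_iff.2 ⟨(le_div_iff₀ hc).2 ht.1, ?_⟩]
  have := (div_lt_iff₀ hc).2 ht.2
  push_cast at this
  exact this

theorem continuousAt_ramp {c t u : ℝ} (hu : u < 1) :
    ContinuousAt (fun z : ℝ × ℝ => ramp c z.1 z.2) (t, u) := by
  by_cases h : fract (t / c) = 0
  · have h1 : Tendsto (fun z : ℝ × ℝ => fract (z.1 / c) * (1 - fract (z.1 / c)) / (1 - z.2))
        (𝓝 (t, u)) (𝓝 (fract (t / c) * (1 - fract (t / c)) / (1 - u))) := by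
      have h2 : Continuous fun z : ℝ × ℝ => fract (z.1 / c) * (1 - fract (z.1 / c)) :=
        continuous_fract_mul.comp (by fun_prop)
      exact (h2.tendsto (t, u)).div
        (by exact (continuous_const.sub continuous_snd).tendsto (t, u)) (by simp; linarith)
    have h3 : ramp c t u = 0 := by
      have h4 : height c t = 0 := by simp [height, h, wave]
      rw [ramp, h4, zero_mul]
    rw [h, zero_mul, zero_div] at h1
    unfold ContinuousAt
    simp only [h3]
    refine tendsto_of_tendsto_of_tendsto_of_le_of_le' tendsto_const_nhds h1
      (Eventually.of_forall fun z => ramp_nonneg) ?_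
    have : ∀ᶠ z : ℝ × ℝ in 𝓝 (t, u), z.2 < 1 :=
      continuous_snd.continuousAt.eventually (Iio_mem_nhds hu)
    exact this.mono fun z hz => ramp_le_fract_mul hz
  · have h1 : ContinuousAt (fun z : ℝ × ℝ => fract (z.1 / c)) (t, u) := by
      have : ContinuousAt (fun t : ℝ => fract (t / c)) t :=
        (continuousAt_fract h).comp (f := fun t : ℝ => t / c) (by fun_prop)
      exact this.comp (f := fun z : ℝ × ℝ => z.1) (x := (t, u)) continuousAt_fst
    have h2 : ContinuousAt (fun z : ℝ × ℝ => height c z.1) (t, u) :=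
      (continuousAt_height h).comp (f := fun z : ℝ × ℝ => z.1) (x := (t, u)) continuousAt_fst
    have h3 : (1 : ℝ) - fract (t / c) ≠ 0 := by linarith [Int.fract_lt_one (t / c)]
    unfold ramp
    refine h2.mul (continuousAt_const.max (continuousAt_const.sub
      ((continuousAt_const.sub continuousAt_snd).div (continuousAt_const.sub h1) h3)))

theorem continuousAt_profile {c t v : ℝ} (hv : fract v ≠ 0) :
    ContinuousAt (fun z : ℝ × ℝ => profile c z.1 z.2) (t, v) := by
  have h1 : ContinuousAt (fun z : ℝ × ℝ => fract z.2) (t, v) :=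
    (continuousAt_fract hv).comp (f := fun z : ℝ × ℝ => z.2) (x := (t, v)) continuousAt_snd
  have h2 : ContinuousAt (fun z : ℝ × ℝ => ramp c z.1 (fract z.2)) (t, v) :=
    ContinuousAt.comp (f := fun z : ℝ × ℝ => (z.1, fract z.2))
      (g := fun z : ℝ × ℝ => ramp c z.1 z.2) (continuousAt_ramp (Int.fract_lt_one v))
      (continuousAt_fst.prodMk h1)
  exact h2.sub h1

theorem continuous_profile_left {c v : ℝ} : Continuous fun t => profile c t v := by
  rw [continuous_iff_continuousAt]
  intro t
  have : ContinuousAt (fun t : ℝ => ramp c t (fract v)) t :=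
    ContinuousAt.comp (f := fun t : ℝ => (t, fract v))
      (g := fun z : ℝ × ℝ => ramp c z.1 z.2) (continuousAt_ramp (Int.fract_lt_one v))
      (by fun_prop)
  exact this.sub continuousAt_const

theorem tendsto_profile_right {c v : ℝ} (t : ℝ) :
    Tendsto (fun v' => profile c t v') (𝓝[>] v) (𝓝 (profile c t v)) := by
  by_cases h : fract v = 0
  · rw [profile_eq_zero h]
    have hf : Tendsto (fun v' : ℝ => fract v') (𝓝[>] v) (𝓝 0) := by
      have := tendsto_fract_right (α := ℝ) ⌊v⌋
      rw [show ((⌊v⌋ : ℤ) : ℝ) = v by linarith [Int.floor_add_fract v]] at this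
      exact (this.mono_left (nhdsWithin_mono _ Ioi_subset_Ici_self)).mono_right
        nhdsWithin_le_nhds
    have hf' := hf.neg
    rw [neg_zero] at hf'
    exact tendsto_of_tendsto_of_tendsto_of_le_of_le hf' tendsto_const_nhds
      (fun _ => neg_fract_le_profile) (fun _ => profile_nonpos)
  · have := (continuousAt_profile (c := c) (t := t) h).comp (f := fun v' : ℝ => (t, v')) (x := v)
      (by fun_prop)
    exact this.tendsto.mono_left nhdsWithin_le_nhds

theorem tendsto_profile_left {c v : ℝ} (t : ℝ) :
    Tendsto (fun v' => profile c t v') (𝓝[<] v) (𝓝 (leftProfile c t v)) := by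
  by_cases h : fract v = 0
  · rw [leftProfile_of_eq h]
    have hf : Tendsto (fun v' : ℝ => fract v') (𝓝[<] v) (𝓝 1) := by
      have := tendsto_fract_left (α := ℝ) ⌊v⌋
      rw [show ((⌊v⌋ : ℤ) : ℝ) = v by linarith [Int.floor_add_fract v]] at this
      exact this.mono_right nhdsWithin_le_nhds
    have hr : Continuous fun u => ramp c t u := by
      unfold ramp
      fun_prop
    have h1 : ramp c t 1 = height c t := by simp [ramp]
    have := ((hr.tendsto 1).comp hf).sub hf
    rwa [h1] at this
  · rw [leftProfile_of_ne h]
    have := (continuousAt_profile (c := c) (t := t) h).comp (f := fun v' : ℝ => (t, v')) (x := v)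
      (by fun_prop)
    exact this.tendsto.mono_left nhdsWithin_le_nhds

end Denjoy

/-! ### Summable weights and the family of leaves -/

namespace Denjoy

open Int (fract floor)

theorem summable_exp_neg_abs : Summable fun k : ℤ => Real.exp (-|(k : ℝ)|) := by
  have h : Summable fun n : ℕ => Real.exp (-(n : ℝ)) := by
    simpa using Real.summable_exp_nat_mul_iff.2 (show (-1 : ℝ) < 0 by norm_num)
  refine Summable.of_nat_of_neg ?_ ?_ <;> simpa using h

/-- The total mass used to normalise the weights. -/
noncomputable def mass : ℝ := Real.exp 1 * ∑' k : ℤ, Real.exp (-|(k : ℝ)|)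

/-- A weight of exponential decay whose translates by integers sum to less than one. -/
noncomputable def weight (t : ℝ) : ℝ := Real.exp (-|t|) / (mass + 1)

theorem mass_nonneg : 0 ≤ mass :=
  mul_nonneg (Real.exp_pos _).le (tsum_nonneg fun _ => (Real.exp_pos _).le)

theorem weight_pos (t : ℝ) : 0 < weight t :=
  div_pos (Real.exp_pos _) (by linarith [mass_nonneg])

theorem continuous_weight : Continuous weight := by
  unfold weight
  fun_prop

theorem weight_le {x x' : ℝ} (h : |x - x'| ≤ 1) : weight x ≤ Real.exp 1 * weight x' := by
  unfold weight
  rw [← mul_div_assoc, ← Real.exp_add]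
  refine div_le_div_of_nonneg_right (Real.exp_le_exp.2 ?_) (by linarith [mass_nonneg])
  have := abs_sub_abs_le_abs_sub x' x
  rw [abs_sub_comm] at this
  linarith

theorem summable_weight_int (n : ℤ) : Summable fun k : ℤ => weight (n - k) := by
  have := (summable_exp_neg_abs.comp_injective (Equiv.subLeft n).injective).div_const (mass + 1)
  refine this.congr fun k => ?_
  simp [weight]

theorem tsum_weight_int (n : ℤ) :
    ∑' k : ℤ, weight (n - k) = (∑' k : ℤ, Real.exp (-|(k : ℝ)|)) / (mass + 1) := by
  rw [← tsum_div_const, ← (Equiv.subLeft n).tsum_eq]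
  simp [weight]

theorem weight_le_floor (x : ℝ) (k : ℤ) :
    weight (x - k) ≤ Real.exp 1 * weight (⌊x⌋ - k) := by
  refine weight_le ?_
  rw [sub_sub_sub_cancel_right, Int.self_sub_floor, abs_of_nonneg (Int.fract_nonneg x)]
  exact (Int.fract_lt_one x).le

theorem summable_weight (x : ℝ) : Summable fun k : ℤ => weight (x - k) :=
  Summable.of_nonneg_of_le (fun _ => (weight_pos _).le) (weight_le_floor x)
    ((summable_weight_int ⌊x⌋).mul_left _)

theorem tsum_weight_lt_one (x : ℝ) : ∑' k : ℤ, weight (x - k) < 1 := by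
  have h1 := (summable_weight x).tsum_le_tsum (weight_le_floor x)
    ((summable_weight_int ⌊x⌋).mul_left _)
  rw [tsum_mul_left, tsum_weight_int, ← mul_div_assoc] at h1
  refine h1.trans_lt ?_
  rw [div_lt_one (by linarith [mass_nonneg]), ← mass]
  linarith

theorem summable_weight_mul (x : ℝ) {γ : ℤ → ℝ} (h : ∀ k, |γ k| ≤ 1) :
    Summable fun k : ℤ => weight (x - k) * γ k := by
  refine Summable.of_norm_bounded (summable_weight x) fun k => ?_
  rw [Real.norm_eq_abs, abs_mul, abs_of_pos (weight_pos _)]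
  exact mul_le_of_le_one_right (weight_pos _).le (h k)

theorem abs_tsum_weight_mul_le (x : ℝ) {γ : ℤ → ℝ} (h : ∀ k, |γ k| ≤ 1) :
    |∑' k : ℤ, weight (x - k) * γ k| ≤ 1 := by
  have : ‖∑' k : ℤ, weight (x - k) * γ k‖ ≤ ∑' k : ℤ, weight (x - k) :=
    tsum_of_norm_bounded (summable_weight x).hasSum fun k => by
      rw [Real.norm_eq_abs, abs_mul, abs_of_pos (weight_pos _)]
      exact mul_le_of_le_one_right (weight_pos _).le (h k)
  exact this.trans (tsum_weight_lt_one x).le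

theorem tendsto_tsum_weight_mul {ι : Type*} {l : Filter ι} {X : ι → ℝ} {G : ι → ℤ → ℝ} {x : ℝ}
    {γ : ℤ → ℝ} (hX : Tendsto X l (𝓝 x)) (hb : ∀ i k, |G i k| ≤ 1)
    (hG : ∀ k, Tendsto (fun i => G i k) l (𝓝 (γ k))) :
    Tendsto (fun i => ∑' k : ℤ, weight (X i - k) * G i k) l
      (𝓝 (∑' k : ℤ, weight (x - k) * γ k)) := by
  refine tendsto_tsum_of_dominated_convergence ((summable_weight x).mul_left (Real.exp 1))
    (fun k => ?_) ?_
  · exact ((continuous_weight.tendsto _).comp (hX.sub_const _)).mul (hG k)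
  · filter_upwards [hX (Metric.closedBall_mem_nhds x one_pos)] with i hi k
    rw [Real.norm_eq_abs, abs_mul, abs_of_pos (weight_pos _)]
    refine (mul_le_of_le_one_right (weight_pos _).le (hb i k)).trans (weight_le ?_)
    rw [sub_sub_sub_cancel_right]
    exact hi

variable {α c x θ θ' : ℝ} {γ γ' : ℤ → ℝ}

/-- The height of the point over `x` with leaf parameter `θ` and jump coordinates `γ`. -/
noncomputable def level (α x θ : ℝ) (γ : ℤ → ℝ) : ℝ :=
  θ + α * x + ∑' k : ℤ, weight (x - k) * γ k

/-- The jump coordinates allowed at the leaf `θ` over `x`. -/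
def Admissible (α c x θ : ℝ) (γ : ℤ → ℝ) : Prop :=
  ∀ k : ℤ, leftProfile c (x - k) (θ + k * α) ≤ γ k ∧ γ k ≤ profile c (x - k) (θ + k * α)

/-- The upper leaf of parameter `θ`. -/
noncomputable def upper (α c x θ : ℝ) : ℝ :=
  level α x θ fun k => profile c (x - k) (θ + k * α)

/-- The lower leaf of parameter `θ`. -/
noncomputable def lower (α c x θ : ℝ) : ℝ :=
  level α x θ fun k => leftProfile c (x - k) (θ + k * α)

theorem Admissible.abs_le (h : Admissible α c x θ γ) (k : ℤ) : |γ k| ≤ 1 :=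
  _root_.abs_le.2 ⟨neg_one_le_leftProfile.trans (h k).1,
    ((h k).2.trans profile_nonpos).trans zero_le_one⟩

theorem admissible_profile : Admissible α c x θ fun k => profile c (x - k) (θ + k * α) :=
  fun _ => ⟨leftProfile_le_profile, le_rfl⟩

theorem admissible_leftProfile :
    Admissible α c x θ fun k => leftProfile c (x - k) (θ + k * α) :=
  fun _ => ⟨le_rfl, leftProfile_le_profile⟩

theorem level_lt_level (h : θ < θ') (hγ : Admissible α c x θ γ) (hγ' : Admissible α c x θ' γ') :
    level α x θ γ < level α x θ' γ' := by
  have h1 : ∀ k : ℤ, weight (x - k) * γ k - weight (x - k) * γ' k ≤ (θ' - θ) * weight (x - k) := by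
    intro k
    have := add_profile_le_add_leftProfile (c := c) (t := x - k)
      (show θ + k * α < θ' + k * α by linarith)
    have h2 : γ k - γ' k ≤ θ' - θ := by linarith [(hγ k).2, (hγ' k).1]
    have := mul_le_mul_of_nonneg_left h2 (weight_pos (x - k)).le
    linarith
  have h3 := ((summable_weight_mul x hγ.abs_le).sub
    (summable_weight_mul x hγ'.abs_le)).tsum_le_tsum h1 ((summable_weight x).mul_left _)
  rw [(summable_weight_mul x hγ.abs_le).tsum_sub (summable_weight_mul x hγ'.abs_le),
    tsum_mul_left] at h3
  have h4 := mul_lt_mul_of_pos_left (tsum_weight_lt_one x) (sub_pos.2 h)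
  rw [level, level]
  linarith

theorem level_le_level (hγ : ∀ k, |γ k| ≤ 1) (hγ' : ∀ k, |γ' k| ≤ 1) (h : ∀ k, γ k ≤ γ' k) :
    level α x θ γ ≤ level α x θ γ' := by
  have := (summable_weight_mul x hγ).tsum_le_tsum
    (fun k => mul_le_mul_of_nonneg_left (h k) (weight_pos (x - k)).le) (summable_weight_mul x hγ')
  rw [level, level]
  linarith

theorem Admissible.level_le_upper (h : Admissible α c x θ γ) : level α x θ γ ≤ upper α c x θ :=
  level_le_level h.abs_le admissible_profile.abs_le fun k => (h k).2

theorem Admissible.lower_le_level (h : Admissible α c x θ γ) : lower α c x θ ≤ level α x θ γ :=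
  level_le_level admissible_leftProfile.abs_le h.abs_le fun k => (h k).1

theorem strictMono_upper : StrictMono (upper α c x) :=
  fun _ _ h => level_lt_level h admissible_profile admissible_profile

theorem upper_lt_lower (h : θ < θ') : upper α c x θ < lower α c x θ' :=
  level_lt_level h admissible_profile admissible_leftProfile

theorem lower_le_upper : lower α c x θ ≤ upper α c x θ := admissible_leftProfile.level_le_upper

theorem abs_upper_sub_le : |upper α c x θ - (θ + α * x)| ≤ 1 := by
  rw [upper, level, add_sub_cancel_left]
  exact abs_tsum_weight_mul_le x admissible_profile.abs_le

theorem continuous_upper (θ : ℝ) : Continuous fun x => upper α c x θ := by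
  rw [continuous_iff_continuousAt]
  intro x
  refine Tendsto.add (by exact Continuous.tendsto (by fun_prop) x)
    (tendsto_tsum_weight_mul tendsto_id (fun x => admissible_profile.abs_le) fun k => ?_)
  exact (continuous_profile_left.comp (continuous_sub_right (k : ℝ))).tendsto x

theorem tendsto_upper_right (x θ : ℝ) :
    Tendsto (upper α c x) (𝓝[>] θ) (𝓝 (upper α c x θ)) := by
  refine Tendsto.add ((show Continuous fun θ : ℝ => θ + α * x by fun_prop).tendsto θ |>.mono_left
    nhdsWithin_le_nhds) (tendsto_tsum_weight_mul tendsto_const_nhds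
      (fun θ => admissible_profile.abs_le) fun k => ?_)
  refine (tendsto_profile_right (x - k)).comp (tendsto_nhdsWithin_iff.2 ⟨?_, ?_⟩)
  · exact ((continuous_add_const _).tendsto θ).mono_left nhdsWithin_le_nhds
  · filter_upwards [self_mem_nhdsWithin] with θ' h
    have h : θ < θ' := h
    simpa using h

theorem tendsto_upper_left (x θ : ℝ) :
    Tendsto (upper α c x) (𝓝[<] θ) (𝓝 (lower α c x θ)) := by
  refine Tendsto.add ((show Continuous fun θ : ℝ => θ + α * x by fun_prop).tendsto θ |>.mono_left
    nhdsWithin_le_nhds) (tendsto_tsum_weight_mul tendsto_const_nhds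
      (fun θ => admissible_profile.abs_le) fun k => ?_)
  refine (tendsto_profile_left (x - k)).comp (tendsto_nhdsWithin_iff.2 ⟨?_, ?_⟩)
  · exact ((continuous_add_const _).tendsto θ).mono_left nhdsWithin_le_nhds
  · filter_upwards [self_mem_nhdsWithin] with θ' h
    have h : θ' < θ := h
    simpa using h

/-- The leaf parameter of a point of the plane. -/
noncomputable def param (α c x y : ℝ) : ℝ := sSup {θ | upper α c x θ ≤ y}

theorem isLUB_param (α c x y : ℝ) : IsLUB {θ | upper α c x θ ≤ y} (param α c x y) := by
  refine Real.isLUB_sSup ⟨y - α * x - 1, ?_⟩ ⟨y - α * x + 1, fun θ hθ => ?_⟩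
  · have := (abs_le.1 (abs_upper_sub_le (α := α) (c := c) (x := x) (θ := y - α * x - 1))).2
    simp only [mem_ofPred_eq]
    linarith
  · have := (abs_le.1 (abs_upper_sub_le (α := α) (c := c) (x := x) (θ := θ))).1
    simp only [mem_ofPred_eq] at hθ
    linarith

theorem upper_le_of_lt_param {y : ℝ} (h : θ < param α c x y) : upper α c x θ ≤ y := by
  obtain ⟨θ', h1, h2⟩ := (lt_isLUB_iff (isLUB_param α c x y)).1 h
  exact (strictMono_upper h2).le.trans h1

theorem lt_upper_of_param_lt {y : ℝ} (h : param α c x y < θ) : y < upper α c x θ := by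
  by_contra! h1
  exact absurd ((isLUB_param α c x y).1 h1) (not_le.2 h)

theorem lower_param_le (x y : ℝ) : lower α c x (param α c x y) ≤ y :=
  le_of_tendsto (tendsto_upper_left x _) <| by
    filter_upwards [self_mem_nhdsWithin] with θ h using upper_le_of_lt_param h

theorem le_upper_param (x y : ℝ) : y ≤ upper α c x (param α c x y) :=
  ge_of_tendsto (tendsto_upper_right x _) <| by
    filter_upwards [self_mem_nhdsWithin] with θ h using (lt_upper_of_param_lt h).le

theorem param_eq {y : ℝ} (h1 : lower α c x θ ≤ y) (h2 : y ≤ upper α c x θ) :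
    param α c x y = θ := by
  rcases lt_trichotomy (param α c x y) θ with h | h | h
  · exact absurd (upper_lt_lower h) (not_lt.2 (h1.trans (le_upper_param x y)))
  · exact h
  · exact absurd (upper_lt_lower h) (not_lt.2 ((lower_param_le x y).trans h2))

theorem continuous_param : Continuous fun z : ℝ × ℝ => param α c z.1 z.2 := by
  rw [continuous_iff_continuousAt]
  rintro ⟨x, y⟩
  have hcont : ∀ θ, Continuous fun z : ℝ × ℝ => upper α c z.1 θ := fun θ =>
    (continuous_upper θ).comp continuous_fst
  refine tendsto_order.2 ⟨fun a ha => ?_, fun a ha => ?_⟩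
  · obtain ⟨b, hb1, hb2⟩ := exists_between ha
    obtain ⟨d, hd1, hd2⟩ := exists_between hb2
    have : upper α c x b < y := (strictMono_upper hd1).trans_le (upper_le_of_lt_param hd2)
    have ho := (isOpen_lt (hcont b) continuous_snd).mem_nhds (show (x, y) ∈ _ from this)
    filter_upwards [ho] with z hz
    exact hb1.trans_le ((isLUB_param α c z.1 z.2).1 (le_of_lt hz))
  · obtain ⟨b, hb1, hb2⟩ := exists_between ha
    have ho := (isOpen_lt continuous_snd (hcont b)).mem_nhds
      (show (x, y) ∈ _ from lt_upper_of_param_lt hb1)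
    filter_upwards [ho] with z hz
    refine lt_of_le_of_lt ?_ hb2
    by_contra! h
    exact absurd (upper_le_of_lt_param h) (not_le.2 hz)

end Denjoy

/-! ### Jump coordinates -/

namespace Denjoy

open Int (fract floor)

variable {α c x y θ θ' : ℝ} {γ γ' : ℤ → ℝ}

theorem jump_unique (hα : Irrational α) {j k : ℤ} (hj : fract (θ + j * α) = 0)
    (hk : fract (θ + k * α) = 0) : j = k := by
  rw [Int.fract_eq_zero_iff] at hj hk
  obtain ⟨a, ha⟩ := hj
  obtain ⟨b, hb⟩ := hk
  by_contra h
  have h1 : ((j - k : ℤ) : ℝ) * α = ((a - b : ℤ) : ℝ) := by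
    push_cast
    linarith
  exact (hα.intCast_mul (sub_ne_zero.2 h)).ne_int _ h1

theorem level_sub_level (hγ : ∀ k, |γ k| ≤ 1) (hγ' : ∀ k, |γ' k| ≤ 1) {k : ℤ}
    (h : ∀ j, j ≠ k → γ j = γ' j) :
    level α x θ γ - level α x θ γ' = weight (x - k) * (γ k - γ' k) := by
  rw [level, level, add_sub_add_left_eq_sub,
    ← (summable_weight_mul x hγ).tsum_sub (summable_weight_mul x hγ'), tsum_eq_single k]
  · ring
  · intro j hj
    rw [h j hj, sub_self]

theorem Admissible.eq_of_ne (hγ : Admissible α c x θ γ) (hγ' : Admissible α c x θ γ') {k : ℤ}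
    (h : fract (θ + k * α) ≠ 0) : γ k = γ' k := by
  have h1 := hγ k
  have h2 := hγ' k
  rw [leftProfile_of_ne h] at h1 h2
  exact (le_antisymm h1.2 h1.1).trans (le_antisymm h2.2 h2.1).symm

theorem Admissible.level_sub_level (hα : Irrational α) (hγ : Admissible α c x θ γ)
    (hγ' : Admissible α c x θ γ') {k : ℤ} (hk : fract (θ + k * α) = 0) :
    level α x θ γ - level α x θ γ' = weight (x - k) * (γ k - γ' k) :=
  Denjoy.level_sub_level hγ.abs_le hγ'.abs_le fun _ hj =>
    hγ.eq_of_ne hγ' fun h => hj (jump_unique hα h hk)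

theorem Admissible.eq_of_level_eq (hα : Irrational α) (hγ : Admissible α c x θ γ)
    (hγ' : Admissible α c x θ γ') (h : level α x θ γ = level α x θ γ') : γ = γ' := by
  funext k
  by_cases hk : fract (θ + k * α) = 0
  · have := hγ.level_sub_level hα hγ' hk
    rw [h, sub_self, zero_eq_mul] at this
    linarith [this.resolve_left (weight_pos _).ne']
  · exact hγ.eq_of_ne hγ' hk

theorem lower_eq_of_jump (hα : Irrational α) {k : ℤ} (hk : fract (θ + k * α) = 0) :
    lower α c x θ = upper α c x θ - weight (x - k) * (1 - height c (x - k)) := by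
  have := (admissible_profile (c := c) (x := x)).level_sub_level hα admissible_leftProfile hk
  simp only [leftProfile_of_eq hk, profile_eq_zero hk] at this
  rw [upper, lower]
  linarith

theorem lower_eq_upper (h : ∀ k : ℤ, fract (θ + k * α) ≠ 0) :
    lower α c x θ = upper α c x θ := by
  simp only [lower, upper, leftProfile_of_ne (h _)]

/-- The jump coordinates of a point of the plane. -/
noncomputable def coord (α c x y : ℝ) (k : ℤ) : ℝ :=
  profile c (x - k) (param α c x y + k * α) -
    if fract (param α c x y + k * α) = 0 then
      (upper α c x (param α c x y) - y) / weight (x - k) else 0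

theorem admissible_coord (hα : Irrational α) (x y : ℝ) :
    Admissible α c x (param α c x y) (coord α c x y) := by
  intro k
  unfold coord
  split_ifs with hk
  · have h1 := lower_param_le (α := α) (c := c) x y
    have h2 := le_upper_param (α := α) (c := c) x y
    rw [lower_eq_of_jump hα hk] at h1
    have hw := weight_pos (x - k)
    rw [leftProfile_of_eq hk, profile_eq_zero hk, zero_sub, neg_nonpos]
    refine ⟨?_, div_nonneg (sub_nonneg.2 h2) hw.le⟩
    rw [le_neg, neg_sub, div_le_iff₀ hw]
    linarith
  · rw [leftProfile_of_ne hk]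
    simp

theorem level_coord (hα : Irrational α) (x y : ℝ) :
    level α x (param α c x y) (coord α c x y) = y := by
  by_cases h : ∃ k : ℤ, fract (param α c x y + k * α) = 0
  · obtain ⟨k, hk⟩ := h
    have := (admissible_profile (c := c) (x := x)).level_sub_level hα (admissible_coord hα x y) hk
    have hw := weight_pos (x - k)
    simp only [coord, hk, if_true, sub_sub_cancel] at this
    rw [mul_div_cancel₀ _ hw.ne', upper] at this
    linarith
  · push Not at h
    have h1 := lower_param_le (α := α) (c := c) x y
    rw [lower_eq_upper h] at h1
    have h2 : coord α c x y = fun k : ℤ => profile c (x - k) (param α c x y + k * α) := by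
      funext k
      rw [coord, if_neg (h k), sub_zero]
    rw [h2, ← upper]
    exact le_antisymm h1 (le_upper_param x y)

theorem Admissible.param_level (h : Admissible α c x θ γ) :
    param α c x (level α x θ γ) = θ :=
  param_eq h.lower_le_level h.level_le_upper

theorem Admissible.coord_level (hα : Irrational α) (h : Admissible α c x θ γ) :
    coord α c x (level α x θ γ) = γ := by
  have h1 := admissible_coord (c := c) hα x (level α x θ γ)
  have h2 := level_coord (c := c) hα x (level α x θ γ)
  rw [h.param_level] at h1 h2
  exact h1.eq_of_level_eq hα h h2

theorem continuousAt_coord_of_ne {z : ℝ × ℝ} {k : ℤ}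
    (h : fract (param α c z.1 z.2 + k * α) ≠ 0) :
    ContinuousAt (fun z : ℝ × ℝ => coord α c z.1 z.2 k) z := by
  have h1 : Continuous fun z : ℝ × ℝ => param α c z.1 z.2 + k * α :=
    continuous_param.add_const _
  have h2 : ContinuousAt (fun z : ℝ × ℝ => profile c (z.1 - k) (param α c z.1 z.2 + k * α)) z :=
    ContinuousAt.comp (f := fun z : ℝ × ℝ => (z.1 - k, param α c z.1 z.2 + k * α))
      (g := fun z : ℝ × ℝ => profile c z.1 z.2) (continuousAt_profile h)
      ((continuous_fst.sub continuous_const).prodMk h1).continuousAt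
  refine h2.congr ?_
  filter_upwards [((continuousAt_fract h).comp (f := fun z : ℝ × ℝ => param α c z.1 z.2 + k * α)
    h1.continuousAt).eventually_ne h] with z hz
  rw [coord, if_neg (show fract (param α c z.1 z.2 + k * α) ≠ 0 from hz), sub_zero]

theorem continuous_coord (hα : Irrational α) (k : ℤ) :
    Continuous fun z : ℝ × ℝ => coord α c z.1 z.2 k := by
  rw [continuous_iff_continuousAt]
  intro z
  by_cases h : fract (param α c z.1 z.2 + k * α) = 0
  · have hb : ∀ (z : ℝ × ℝ) (j : ℤ), |update (coord α c z.1 z.2) k 0 j| ≤ 1 := fun z j => by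
      rcases eq_or_ne j k with rfl | hj
      · simp
      · rw [update_of_ne hj]
        exact (admissible_coord hα _ _).abs_le j
    have h1 : Tendsto
        (fun z : ℝ × ℝ => ∑' j : ℤ, weight (z.1 - j) * update (coord α c z.1 z.2) k 0 j) (𝓝 z)
        (𝓝 (∑' j : ℤ, weight (z.1 - j) * update (coord α c z.1 z.2) k 0 j)) := by
      refine tendsto_tsum_weight_mul (continuous_fst.tendsto z) hb fun j => ?_
      rcases eq_or_ne j k with rfl | hj
      · simp
      · simp only [update_of_ne hj]
        exact continuousAt_coord_of_ne fun h' => hj (jump_unique hα h' h)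
    have h2 : ∀ z : ℝ × ℝ, coord α c z.1 z.2 k = (z.2 - (param α c z.1 z.2 + α * z.1 +
        ∑' j : ℤ, weight (z.1 - j) * update (coord α c z.1 z.2) k 0 j)) / weight (z.1 - k) := by
      intro z
      have := level_sub_level (α := α) (x := z.1) (θ := param α c z.1 z.2)
        (admissible_coord hα z.1 z.2).abs_le (hb z) (k := k) fun j hj => (update_of_ne hj _ _).symm
      rw [level_coord hα, update_self, sub_zero, level] at this
      rw [this, mul_div_cancel_left₀ _ (weight_pos _).ne']
    simp only [ContinuousAt, h2]
    refine (continuous_snd.continuousAt.tendsto.sub (Tendsto.add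
      (continuous_param.continuousAt.tendsto.add ?_) h1)).div ?_ (weight_pos _).ne'
    · exact Continuous.tendsto (by fun_prop) z
    · exact (continuous_weight.comp (continuous_fst.sub continuous_const)).tendsto z
  · exact continuousAt_coord_of_ne h

/-! ### Deck transformations -/

theorem level_add_int (l : ℤ) : level α x (θ + l) γ = level α x θ γ + l := by
  rw [level, level]
  ring

theorem level_deck (k : ℤ) :
    level α (x + k) (θ - k * α) (fun j => γ (j - k)) = level α x θ γ := by
  rw [level, level, ← (Equiv.subRight k).tsum_eq fun j : ℤ => weight (x - j) * γ j]
  congr 1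
  · ring
  · refine tsum_congr fun j => ?_
    simp only [Equiv.subRight_apply]
    push_cast
    ring_nf

theorem Admissible.add_int (h : Admissible α c x θ γ) (l : ℤ) :
    Admissible α c x (θ + l) γ := by
  intro k
  have := h k
  rwa [add_right_comm, leftProfile_add_int, profile_add_int]

theorem Admissible.deck (h : Admissible α c x θ γ) (k : ℤ) :
    Admissible α c (x + k) (θ - k * α) (fun j => γ (j - k)) := by
  intro j
  have := h (j - k)
  push_cast at this
  rwa [show x - (j - k : ℝ) = x + k - j by ring,
    show θ + (j - k : ℝ) * α = θ - k * α + j * α by ring] at this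

theorem upper_add_int (l : ℤ) : upper α c x (θ + l) = upper α c x θ + l := by
  rw [upper, level_add_int, upper]
  simp only [add_right_comm _ (l : ℝ), profile_add_int]

theorem upper_deck (k : ℤ) : upper α c (x + k) (θ - k * α) = upper α c x θ := by
  refine Eq.trans ?_ (level_deck k)
  rw [upper]
  congr 1
  funext j
  push_cast
  ring_nf

theorem param_add_int (hα : Irrational α) (l : ℤ) :
    param α c x (y + l) = param α c x y + l := by
  have := ((admissible_coord (c := c) hα x y).add_int l).param_level
  rwa [level_add_int, level_coord hα] at this

theorem coord_add_int (hα : Irrational α) (l : ℤ) :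
    coord α c x (y + l) = coord α c x y := by
  have := ((admissible_coord (c := c) hα x y).add_int l).coord_level hα
  rwa [level_add_int, level_coord hα] at this

theorem param_deck (hα : Irrational α) (k : ℤ) :
    param α c (x + k) y = param α c x y - k * α := by
  have := ((admissible_coord (c := c) hα x y).deck k).param_level
  rwa [level_deck, level_coord hα] at this

theorem coord_deck (hα : Irrational α) (k : ℤ) :
    coord α c (x + k) y = fun j => coord α c x y (j - k) := by
  have := ((admissible_coord (c := c) hα x y).deck k).coord_level hα
  rwa [level_deck, level_coord hα] at this

/-! ### The sliding map -/

/-- The height reached from `(x, y)` by moving the abscissa by `v` along the leaf. -/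
noncomputable def slide (α c v x y : ℝ) : ℝ :=
  level α (x + v) (param α c x y) (coord α c x y)

theorem continuous_slide (hα : Irrational α) (v : ℝ) :
    Continuous fun z : ℝ × ℝ => slide α c v z.1 z.2 := by
  rw [continuous_iff_continuousAt]
  intro z
  refine Tendsto.add (continuous_param.continuousAt.tendsto.add ?_)
    (tendsto_tsum_weight_mul ?_ (fun z => (admissible_coord hα z.1 z.2).abs_le)
      fun k => (continuous_coord hα k).tendsto z)
  · exact Continuous.tendsto (by fun_prop) z
  · exact Continuous.tendsto (by fun_prop) z

theorem slide_add_int (hα : Irrational α) (v : ℝ) (l : ℤ) :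
    slide α c v x (y + l) = slide α c v x y + l := by
  rw [slide, param_add_int hα, coord_add_int hα, level_add_int, slide]

theorem slide_deck (hα : Irrational α) (v : ℝ) (k : ℤ) :
    slide α c v (x + k) y = slide α c v x y := by
  rw [slide, param_deck hα, coord_deck hα, add_right_comm, level_deck, slide]

theorem Admissible.add_mul (h : Admissible α c x θ γ) (hc : 0 < c) (n : ℤ) :
    Admissible α c (x + n * c) θ γ := by
  intro k
  have := h k
  rwa [add_sub_right_comm, leftProfile_add_mul hc, profile_add_mul hc]

theorem param_slide (hα : Irrational α) (hc : 0 < c) (n : ℤ) :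
    param α c (x + n * c) (slide α c (n * c) x y) = param α c x y :=
  ((admissible_coord (c := c) hα x y).add_mul hc n).param_level

theorem slide_slide (hα : Irrational α) (hc : 0 < c) (n m : ℤ) :
    slide α c (m * c) (x + n * c) (slide α c (n * c) x y) =
      slide α c ((n + m : ℤ) * c) x y := by
  have := ((admissible_coord (c := c) hα x y).add_mul hc n).coord_level hα
  rw [slide, param_slide hα hc, slide, this, slide]
  congr 1
  push_cast
  ring

theorem slide_zero (hα : Irrational α) : slide α c 0 x y = y := by
  rw [slide, add_zero, level_coord hα]

theorem slide_upper (hα : Irrational α) (hc : 0 < c) (n : ℤ) :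
    slide α c (n * c) x (upper α c x θ) = upper α c (x + n * c) θ := by
  rw [slide, upper, admissible_profile.param_level, admissible_profile.coord_level hα, upper]
  congr 1
  funext k
  rw [add_sub_right_comm, profile_add_mul hc]

end Denjoy

/-! ### The torus homeomorphism -/

namespace Denjoy

open Int (fract floor)

/-- The covering of the torus by the plane. -/
def proj (z : ℝ × ℝ) : AddCircle (1 : ℝ) × AddCircle (1 : ℝ) := (z.1, z.2)

theorem isOpenQuotientMap_proj : IsOpenQuotientMap proj :=
  (QuotientAddGroup.isOpenQuotientMap_mk (N := AddSubgroup.zmultiples (1 : ℝ))).prodMap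
    (QuotientAddGroup.isOpenQuotientMap_mk (N := AddSubgroup.zmultiples (1 : ℝ)))

theorem continuous_proj : Continuous proj := isOpenQuotientMap_proj.continuous

theorem coe_eq_coe_iff {x y : ℝ} :
    (x : AddCircle (1 : ℝ)) = y ↔ ∃ k : ℤ, y = x + k := by
  rw [eq_comm, ← sub_eq_zero, ← AddCircle.coe_sub, AddCircle.coe_eq_zero_iff]
  refine exists_congr fun k => ?_
  rw [zsmul_eq_mul, mul_one]
  constructor <;> intro h <;> linarith

theorem proj_eq_proj_iff {z w : ℝ × ℝ} :
    proj z = proj w ↔ ∃ k l : ℤ, w = (z.1 + k, z.2 + l) := by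
  simp only [proj, Prod.ext_iff, coe_eq_coe_iff, exists_and_left, exists_and_right]

variable {α c x y θ θ' : ℝ} {γ γ' : ℤ → ℝ}

theorem slide_sub_factorsThrough (hα : Irrational α) (c v : ℝ) :
    FactorsThrough (fun z : ℝ × ℝ => slide α c v z.1 z.2 - z.2) proj := fun z w h => by
  obtain ⟨k, l, rfl⟩ := proj_eq_proj_iff.1 h
  simp [slide_add_int hα, slide_deck hα]

/-- The vertical displacement of the sliding map, as a function on the torus. -/
noncomputable def drift (hα : Irrational α) (c v : ℝ) :
    C(AddCircle (1 : ℝ) × AddCircle (1 : ℝ), ℝ) :=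
  IsQuotientMap.lift (f := ⟨proj, continuous_proj⟩) isOpenQuotientMap_proj.isQuotientMap
    ⟨fun z : ℝ × ℝ => slide α c v z.1 z.2 - z.2, (continuous_slide hα v).sub continuous_snd⟩
    (slide_sub_factorsThrough hα c v)

theorem drift_proj (hα : Irrational α) (c v : ℝ) (z : ℝ × ℝ) :
    drift hα c v (proj z) = slide α c v z.1 z.2 - z.2 :=
  DFunLike.congr_fun (IsQuotientMap.lift_comp (f := ⟨proj, continuous_proj⟩)
    isOpenQuotientMap_proj.isQuotientMap ⟨fun z : ℝ × ℝ => slide α c v z.1 z.2 - z.2,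
      (continuous_slide hα v).sub continuous_snd⟩ (slide_sub_factorsThrough hα c v)) z

/-- The sliding maps induced on the torus. -/
noncomputable def flow (hα : Irrational α) (c : ℝ) (n : ℤ)
    (t : AddCircle (1 : ℝ) × AddCircle (1 : ℝ)) : AddCircle (1 : ℝ) × AddCircle (1 : ℝ) :=
  (t.1 + ((n * c : ℝ) : AddCircle (1 : ℝ)), t.2 + (drift hα c (n * c) t : AddCircle (1 : ℝ)))

theorem continuous_coe : Continuous fun x : ℝ => (x : AddCircle (1 : ℝ)) :=
  AddCircle.continuous_mk' 1

theorem continuous_flow (hα : Irrational α) (n : ℤ) : Continuous (flow hα c n) :=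
  (continuous_fst.add continuous_const).prodMk
    (continuous_snd.add (continuous_coe.comp (drift hα c (n * c)).continuous))

theorem flow_proj (hα : Irrational α) (n : ℤ) (z : ℝ × ℝ) :
    flow hα c n (proj z) = proj (z.1 + n * c, slide α c (n * c) z.1 z.2) := by
  rw [flow, drift_proj]
  simp only [proj, ← AddCircle.coe_add, add_sub_cancel]

theorem flow_flow (hα : Irrational α) (hc : 0 < c) (n m : ℤ)
    (t : AddCircle (1 : ℝ) × AddCircle (1 : ℝ)) :
    flow hα c m (flow hα c n t) = flow hα c (n + m) t := by
  obtain ⟨z, rfl⟩ := isOpenQuotientMap_proj.surjective t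
  rw [flow_proj, flow_proj, flow_proj, slide_slide hα hc]
  congr 2
  push_cast
  ring

theorem flow_zero (hα : Irrational α) (t : AddCircle (1 : ℝ) × AddCircle (1 : ℝ)) :
    flow hα c 0 t = t := by
  obtain ⟨z, rfl⟩ := isOpenQuotientMap_proj.surjective t
  rw [flow_proj, Int.cast_zero, zero_mul, slide_zero hα, add_zero]

/-- The time one sliding map as a homeomorphism of the torus. -/
noncomputable def flowHomeomorph (hα : Irrational α) (hc : 0 < c) :
    (AddCircle (1 : ℝ) × AddCircle (1 : ℝ)) ≃ₜ (AddCircle (1 : ℝ) × AddCircle (1 : ℝ)) where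
  toFun := flow hα c 1
  invFun := flow hα c (-1)
  left_inv t := by rw [flow_flow hα hc, add_neg_cancel, flow_zero]
  right_inv t := by rw [flow_flow hα hc, neg_add_cancel, flow_zero]
  continuous_toFun := continuous_flow hα 1
  continuous_invFun := continuous_flow hα (-1)

theorem flowHomeomorph_iterate (hα : Irrational α) (hc : 0 < c) (n : ℕ)
    (t : AddCircle (1 : ℝ) × AddCircle (1 : ℝ)) :
    (flowHomeomorph hα hc)^[n] t = flow hα c n t := by
  induction n with
  | zero => rw [iterate_zero_apply, Nat.cast_zero, flow_zero]
  | succ n ih =>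
    rw [iterate_succ_apply', ih, Nat.cast_succ, ← flow_flow hα hc]
    rfl

theorem flowHomeomorph_homotopic (hα : Irrational α) (hc : 0 < c) :
    ContinuousMap.Homotopic ⟨flowHomeomorph hα hc, (flowHomeomorph hα hc).continuous⟩
      (ContinuousMap.id (AddCircle (1 : ℝ) × AddCircle (1 : ℝ))) := by
  refine ContinuousMap.Homotopic.symm ⟨⟨⟨fun p => (p.2.1 + ((p.1 * c : ℝ) : AddCircle (1 : ℝ)),
    p.2.2 + ((p.1 * drift hα c (1 * c) p.2 : ℝ) : AddCircle (1 : ℝ))), ?_⟩, ?_, ?_⟩⟩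
  · have h1 : Continuous fun p : unitInterval × (AddCircle (1 : ℝ) × AddCircle (1 : ℝ)) =>
        ((p.1 * c : ℝ) : AddCircle (1 : ℝ)) := continuous_coe.comp (by fun_prop)
    have h2 : Continuous fun p : unitInterval × (AddCircle (1 : ℝ) × AddCircle (1 : ℝ)) =>
        ((p.1 * drift hα c (1 * c) p.2 : ℝ) : AddCircle (1 : ℝ)) :=
      continuous_coe.comp (by fun_prop)
    exact ((by fun_prop : Continuous fun p : unitInterval × (AddCircle (1 : ℝ) ×
      AddCircle (1 : ℝ)) => p.2.1).add h1).prodMk ((by fun_prop : Continuous fun p :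
        unitInterval × (AddCircle (1 : ℝ) × AddCircle (1 : ℝ)) => p.2.2).add h2)
  · intro t
    simp
  · intro t
    simp [flowHomeomorph, flow]

/-! ### Simultaneous approximation -/

/-- The forward orbits of the translation of the plane by `(c, 0)`, modulo the lattice generated by
`(1, -α)` and `(0, 1)`, are dense. -/
def Spreading (α c : ℝ) : Prop :=
  ∀ a b ε : ℝ, 0 < ε → ∃ (n : ℕ) (k l : ℤ), |(n + 1 : ℕ) * c + k - a| < ε ∧ |l - k * α - b| < ε

theorem exists_nat_mul_near (hα : Irrational α) (b : ℝ) {ε : ℝ} (hε : 0 < ε) (N : ℕ) :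
    ∃ (k : ℕ) (l : ℤ), N ≤ k ∧ |l + k * α - b| < ε := by
  have hcl : MapClusterPt (b : AddCircle (1 : ℝ)) atTop
      (fun n : ℕ => n • (α : AddCircle (1 : ℝ))) := by
    rw [mapClusterPt_atTop_nsmul_iff_mem_topologicalClosure_zmultiples]
    have := (AddCircle.denseRange_zsmul_coe_iff (a := α) (p := 1)).2 (by simpa using hα)
    exact this (b : AddCircle (1 : ℝ))
  have hU : (fun x : ℝ => (x : AddCircle (1 : ℝ))) '' ball b ε ∈ 𝓝 (b : AddCircle (1 : ℝ)) :=
    (QuotientAddGroup.isOpenMap_coe).image_mem_nhds (ball_mem_nhds b hε)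
  obtain ⟨k, hk, x, hx, hxk⟩ := (frequently_atTop.1 (mapClusterPt_iff_frequently.1 hcl _ hU)) N
  rw [← AddCircle.coe_nsmul] at hxk
  obtain ⟨l, hl⟩ := coe_eq_coe_iff.1 hxk
  refine ⟨k, -l, hk, ?_⟩
  rw [nsmul_eq_mul] at hl
  rw [mem_ball, Real.dist_eq] at hx
  rw [hl]
  push_cast
  simpa using hx

theorem exists_spreading_between (hα : Irrational α) (a b : ℝ) {ε c₁ c₂ : ℝ} (hε : 0 < ε)
    (h0 : 0 < c₁) (h : c₁ < c₂) : ∃ c ∈ Ioo c₁ c₂, ∃ (n : ℕ) (k l : ℤ),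
      |(n + 1 : ℕ) * c + k - a| < ε ∧ |l - k * α - b| < ε := by
  have h3 : 0 < 1 / c₁ - 1 / c₂ := sub_pos.2 (one_div_lt_one_div_of_lt h0 h)
  obtain ⟨N, hN⟩ := exists_nat_gt (max (-a) (1 / (1 / c₁ - 1 / c₂) - a))
  obtain ⟨K, l, hK, hl⟩ := exists_nat_mul_near hα b hε N
  have hK' : (N : ℝ) ≤ K := by exact_mod_cast hK
  obtain ⟨hN1, hN2⟩ := max_lt_iff.1 hN
  set A := a + K with hA
  have hA0 : 0 < A := by linarith
  have hA1 : 1 / (1 / c₁ - 1 / c₂) < A := by linarith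
  rw [div_lt_iff₀ h3] at hA1
  set n := ⌊A / c₂⌋₊
  have hn1 : A / c₂ < n + 1 := Nat.lt_floor_add_one _
  have hn2 : (n : ℝ) ≤ A / c₂ := Nat.floor_le (div_pos hA0 (h0.trans h)).le
  have hn3 : (n : ℝ) + 1 < A / c₁ := by
    have : A / c₁ - A / c₂ = A * (1 / c₁ - 1 / c₂) := by ring
    linarith
  have hn0 : (0 : ℝ) < n + 1 := by positivity
  refine ⟨A / (n + 1), ⟨?_, ?_⟩, n, -K, l, ?_, ?_⟩
  · rw [lt_div_iff₀ hn0]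
    rw [lt_div_iff₀ h0] at hn3
    linarith
  · rw [div_lt_iff₀ hn0]
    rw [div_lt_iff₀ (h0.trans h)] at hn1
    linarith
  · push_cast
    rw [mul_div_cancel₀ _ hn0.ne', hA]
    simpa using hε
  · push_cast
    simpa using hl

theorem exists_spreading (hα : Irrational α) : ∃ c, 0 < c ∧ Spreading α c := by
  let U : ℚ × ℚ × ℕ → Set ℝ := fun i => Iio 0 ∪ ⋃ (n : ℕ) (k : ℤ) (l : ℤ),
    {c | |(n + 1 : ℕ) * c + k - i.1| < 1 / (i.2.2 + 1) ∧ |l - k * α - i.2.1| < 1 / (i.2.2 + 1)}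
  have ho : ∀ i, IsOpen (U i) := fun i => isOpen_Iio.union <| isOpen_iUnion fun n =>
    isOpen_iUnion fun k => isOpen_iUnion fun l =>
      IsOpen.and (isOpen_lt (by fun_prop) continuous_const) isOpen_const
  have hd : ∀ i, Dense (U i) := fun i => dense_of_exists_between fun a b hab => by
    rcases lt_or_ge a 0 with ha | ha
    · obtain ⟨c, h1, h2⟩ := exists_between (lt_min hab ha)
      exact ⟨c, Or.inl (h2.trans_le (min_le_right _ _)), h1, h2.trans_le (min_le_left _ _)⟩
    · obtain ⟨d, h1, h2⟩ := exists_between hab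
      obtain ⟨c, hc, n, k, l, h3⟩ := exists_spreading_between hα (i.1 : ℝ) (i.2.1 : ℝ)
        (ε := 1 / (i.2.2 + 1)) (by positivity) (ha.trans_lt h1) h2
      refine ⟨c, Or.inr ?_, h1.trans hc.1, hc.2⟩
      simp only [mem_iUnion]
      exact ⟨n, k, l, h3⟩
  obtain ⟨c, hc, hc0 : 0 < c⟩ := (dense_iInter_of_isOpen ho hd).exists_mem_open isOpen_Ioi
    (nonempty_Ioi (a := (0 : ℝ)))
  refine ⟨c, hc0, fun a b ε hε => ?_⟩
  obtain ⟨m, hm⟩ := exists_nat_one_div_lt (half_pos hε)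
  obtain ⟨a', ha1, ha2⟩ := exists_rat_btwn (show a < a + ε / 2 by linarith)
  obtain ⟨b', hb1, hb2⟩ := exists_rat_btwn (show b < b + ε / 2 by linarith)
  have := (mem_iInter.1 hc (a', b', m)).resolve_left (not_lt.2 hc0.le)
  simp only [mem_iUnion] at this
  obtain ⟨n, k, l, h1, h2⟩ := this
  refine ⟨n, k, l, ?_, ?_⟩
  · have h1 := abs_lt.1 (h1.trans hm)
    exact abs_lt.2 ⟨by linarith, by linarith⟩
  · have h2 := abs_lt.1 (h2.trans hm)
    exact abs_lt.2 ⟨by linarith, by linarith⟩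

/-! ### The minimal set -/

/-- The points of the plane on the leaves without jumps. -/
def regular (α c : ℝ) : Set (ℝ × ℝ) := {z | ∀ k : ℤ, fract (param α c z.1 z.2 + k * α) ≠ 0}

theorem eq_upper_of_regular {z : ℝ × ℝ} (h : z ∈ regular α c) :
    z.2 = upper α c z.1 (param α c z.1 z.2) :=
  le_antisymm (le_upper_param _ _) (lower_eq_upper h ▸ lower_param_le _ _)

theorem exists_forall_param_near {w : ℝ × ℝ} (hw : w ∈ regular α c) {U : Set (ℝ × ℝ)}
    (hU : U ∈ 𝓝 w) : ∃ ε > 0, ∀ z : ℝ × ℝ, |z.1 - w.1| < ε →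
      |param α c z.1 z.2 - param α c w.1 w.2| < ε → z ∈ U := by
  obtain ⟨r, hr, hrU⟩ := Metric.mem_nhds_iff.1 hU
  have e := eq_upper_of_regular hw
  set θ := param α c w.1 w.2 with hθ
  have h1 := tendsto_upper_left (α := α) (c := c) w.1 θ
  have h2 := tendsto_upper_right (α := α) (c := c) w.1 θ
  rw [lower_eq_upper hw, ← e] at h1
  rw [← e] at h2
  obtain ⟨a, ha1, ha2⟩ := ((h1.eventually (lt_mem_nhds (show w.2 - r < w.2 by linarith))).and
    self_mem_nhdsWithin).exists
  obtain ⟨b, hb1, hb2⟩ := ((h2.eventually (gt_mem_nhds (show w.2 < w.2 + r by linarith))).and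
    self_mem_nhdsWithin).exists
  have h3 := ((continuous_upper (α := α) (c := c) a).continuousAt.eventually
    (lt_mem_nhds ha1)).and ((continuous_upper (α := α) (c := c) b).continuousAt.eventually
    (gt_mem_nhds hb1))
  obtain ⟨d, hd, hd'⟩ := Metric.eventually_nhds_iff.1 h3
  have ha2 : a < θ := ha2
  have hb2 : θ < b := hb2
  refine ⟨min (min d r) (min (θ - a) (b - θ)), by
    refine lt_min (lt_min hd hr) (lt_min ?_ ?_) <;> linarith, fun z hz1 hz2 => hrU ?_⟩
  rw [lt_min_iff, lt_min_iff] at hz1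
  rw [lt_min_iff, lt_min_iff (b := θ - a), abs_lt, abs_lt, abs_lt] at hz2
  obtain ⟨h4, h5⟩ := hd' (y := z.1) hz1.1.1
  have h6 := upper_le_of_lt_param (α := α) (c := c) (x := z.1) (y := z.2) (θ := a) (by linarith)
  have h7 := lt_upper_of_param_lt (α := α) (c := c) (x := z.1) (y := z.2) (θ := b) (by linarith)
  rw [mem_ball, Prod.dist_eq, max_lt_iff, Real.dist_eq, Real.dist_eq]
  exact ⟨hz1.1.2, abs_lt.2 ⟨by linarith, by linarith⟩⟩

theorem exists_flow_mem (hα : Irrational α) (hc : 0 < c) (hs : Spreading α c)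
    (t : AddCircle (1 : ℝ) × AddCircle (1 : ℝ)) {w : ℝ × ℝ} (hw : w ∈ regular α c)
    {U : Set (AddCircle (1 : ℝ) × AddCircle (1 : ℝ))} (hU : U ∈ 𝓝 (proj w)) :
    ∃ n : ℕ, flow hα c (n + 1 : ℕ) t ∈ U := by
  obtain ⟨z, rfl⟩ := isOpenQuotientMap_proj.surjective t
  obtain ⟨ε, hε, h⟩ := exists_forall_param_near hw (continuous_proj.continuousAt hU)
  obtain ⟨n, k, l, h1, h2⟩ := hs (w.1 - z.1) (param α c w.1 w.2 - param α c z.1 z.2) ε hε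
  refine ⟨n, ?_⟩
  have h3 := h (z.1 + (n + 1 : ℕ) * c + k, slide α c ((n + 1 : ℕ) * c) z.1 z.2 + l) ?_ ?_
  · rw [flow_proj]
    convert! (show proj _ ∈ U from h3) using 1
    rw [proj_eq_proj_iff]
    exact ⟨k, l, rfl⟩
  · dsimp only
    rwa [show z.1 + (n + 1 : ℕ) * c + k - w.1 = (n + 1 : ℕ) * c + k - (w.1 - z.1) by ring]
  · have h4 := param_slide (α := α) (x := z.1) (y := z.2) hα hc (n + 1 : ℕ)
    rw [Int.cast_natCast] at h4
    dsimp only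
    rw [param_deck hα, param_add_int hα, h4]
    convert h2 using 2
    ring

/-- The minimal set in the torus. -/
def minimalSet (α c : ℝ) : Set (AddCircle (1 : ℝ) × AddCircle (1 : ℝ)) :=
  closure (proj '' regular α c)

theorem flow_mem_image (hα : Irrational α) (hc : 0 < c) (n : ℤ)
    {t : AddCircle (1 : ℝ) × AddCircle (1 : ℝ)} (ht : t ∈ proj '' regular α c) :
    flow hα c n t ∈ proj '' regular α c := by
  obtain ⟨z, hz, rfl⟩ := ht
  rw [flow_proj]
  refine mem_image_of_mem _ fun k => ?_
  rw [param_slide hα hc]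
  exact hz k

theorem flow_mem_minimalSet (hα : Irrational α) (hc : 0 < c) (n : ℤ)
    {t : AddCircle (1 : ℝ) × AddCircle (1 : ℝ)} (ht : t ∈ minimalSet α c) :
    flow hα c n t ∈ minimalSet α c :=
  map_mem_closure (continuous_flow hα n) ht fun _ => flow_mem_image hα hc n

theorem flowHomeomorph_mem_iff (hα : Irrational α) (hc : 0 < c)
    (t : AddCircle (1 : ℝ) × AddCircle (1 : ℝ)) :
    t ∈ minimalSet α c ↔ flowHomeomorph hα hc t ∈ minimalSet α c := by
  refine ⟨flow_mem_minimalSet hα hc 1, fun h => ?_⟩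
  have := flow_mem_minimalSet hα hc (-1) h
  rwa [show flow hα c (-1) (flowHomeomorph hα hc t) = t from
    (flowHomeomorph hα hc).symm_apply_apply t] at this

theorem image_minimalSet (hα : Irrational α) (hc : 0 < c) :
    flowHomeomorph hα hc '' minimalSet α c = minimalSet α c := by
  rw [(flowHomeomorph hα hc).image_eq_preimage_symm]
  ext t
  rw [mem_preimage, flowHomeomorph_mem_iff hα hc, Homeomorph.apply_symm_apply]

theorem dense_flow_orbit (hα : Irrational α) (hc : 0 < c) (hs : Spreading α c)
    (t : minimalSet α c) :
    Dense {y : minimalSet α c | ∃ n : ℕ, (y : AddCircle (1 : ℝ) × AddCircle (1 : ℝ)) =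
      flow hα c (n + 1 : ℕ) t} := by
  rw [Subtype.dense_iff]
  refine closure_minimal ?_ isClosed_closure
  rintro _ ⟨w, hw, rfl⟩
  refine mem_closure_iff_nhds.2 fun U hU => ?_
  obtain ⟨n, hn⟩ := exists_flow_mem hα hc hs t hw hU
  exact ⟨_, hn, ⟨_, flow_mem_minimalSet hα hc _ t.2⟩, ⟨n, rfl⟩, rfl⟩

theorem isMinimalMap_minimalSet (hα : Irrational α) (hc : 0 < c) (hs : Spreading α c) :
    IsMinimalMap ((flowHomeomorph hα hc).subtype (flowHomeomorph_mem_iff hα hc) :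
      minimalSet α c → minimalSet α c) := by
  refine ⟨Homeomorph.continuous _, fun t => (dense_flow_orbit hα hc hs t).mono ?_⟩
  have hit : ∀ n : ℕ, ((((flowHomeomorph hα hc).subtype (flowHomeomorph_mem_iff hα hc))^[n] t :
      minimalSet α c) : AddCircle (1 : ℝ) × AddCircle (1 : ℝ)) = flow hα c n t := by
    intro n
    rw [← flowHomeomorph_iterate hα hc]
    induction n with
    | zero => rfl
    | succ n ih =>
      rw [iterate_succ_apply', iterate_succ_apply', ← ih]
      rfl
  rintro y ⟨n, hn⟩
  exact ⟨n, Subtype.ext ((hit _).trans hn.symm)⟩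

end Denjoy

/-! ### The minimal set in the plane -/

namespace Denjoy

open Int (fract floor)

variable {α c x y θ : ℝ}

theorem param_upper : param α c x (upper α c x θ) = θ :=
  param_eq lower_le_upper le_rfl

theorem param_lower : param α c x (lower α c x θ) = θ :=
  param_eq le_rfl lower_le_upper

theorem preimage_minimalSet (hα : Irrational α) :
    proj ⁻¹' minimalSet α c = closure (regular α c) := by
  rw [minimalSet, isOpenQuotientMap_proj.isOpenMap.preimage_closure_eq_closure_preimage
    continuous_proj]
  congr 1
  refine Subset.antisymm ?_ (subset_preimage_image _ _)
  rintro z ⟨w, hw, h⟩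
  obtain ⟨k, l, rfl⟩ := proj_eq_proj_iff.1 h
  intro j
  dsimp only
  rw [param_deck hα, param_add_int hα]
  have := hw (j - k)
  rw [← Int.fract_add_intCast _ l] at this
  convert this using 2
  push_cast
  ring

theorem proj_mem_minimalSet (hα : Irrational α) {z : ℝ × ℝ} :
    proj z ∈ minimalSet α c ↔ z ∈ closure (regular α c) := by
  rw [← preimage_minimalSet hα, mem_preimage]

theorem countable_setOf_exists_fract (α : ℝ) :
    {θ : ℝ | ∃ k : ℤ, fract (θ + k * α) = 0}.Countable := by
  refine (countable_range fun p : ℤ × ℤ => p.1 - p.2 * α).mono ?_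
  rintro θ ⟨k, hk⟩
  obtain ⟨l, hl⟩ := Int.fract_eq_zero_iff.1 hk
  exact ⟨(l, k), by dsimp only; linarith⟩

theorem upper_mem_closure_regular : (x, upper α c x θ) ∈ closure (regular α c) := by
  have h1 := (countable_setOf_exists_fract α).dense_compl ℝ
  have h2 : θ ∈ closure (Ioi θ ∩ {θ : ℝ | ∃ k : ℤ, fract (θ + k * α) = 0}ᶜ) := by
    refine closure_minimal (h1.open_subset_closure_inter isOpen_Ioi) isClosed_closure ?_
    rw [closure_Ioi]
    exact self_mem_Ici
  have := mem_closure_iff_nhdsWithin_neBot.1 h2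
  refine mem_closure_of_tendsto (b := 𝓝[Ioi θ ∩ {θ : ℝ | ∃ k : ℤ, fract (θ + k * α) = 0}ᶜ] θ)
    (tendsto_const_nhds.prodMk_nhds
      ((tendsto_upper_right x θ).mono_left (nhdsWithin_mono _ inter_subset_left))) ?_
  filter_upwards [self_mem_nhdsWithin] with θ' h k hk
  rw [param_upper] at hk
  exact h.2 ⟨k, hk⟩

theorem lower_mem_closure_regular : (x, lower α c x θ) ∈ closure (regular α c) :=
  isClosed_closure.mem_of_tendsto (tendsto_const_nhds.prodMk_nhds (tendsto_upper_left x θ))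
    (Eventually.of_forall fun _ => upper_mem_closure_regular)

theorem notMem_closure_regular {z : ℝ × ℝ} {k : ℤ} (hk : fract (θ + k * α) = 0)
    (h : ∀ᶠ w in 𝓝 z, param α c w.1 w.2 = θ) : z ∉ closure (regular α c) := by
  rw [mem_closure_iff_frequently, not_frequently]
  filter_upwards [h] with w hw hr
  exact hr k (hw ▸ hk)

theorem notMem_closure_regular_of_lt (hα : Irrational α) {k : ℤ} (hk : fract (θ + k * α) = 0)
    (h1 : upper α c x θ - weight (x - k) / 2 < y) (h2 : y < upper α c x θ) :
    (x, y) ∉ closure (regular α c) := by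
  have hu := (continuous_upper (α := α) (c := c) θ).comp (continuous_fst (X := ℝ) (Y := ℝ))
  have hw : Continuous fun w : ℝ × ℝ => weight (w.1 - k) :=
    continuous_weight.comp (by fun_prop)
  refine notMem_closure_regular hk ?_
  filter_upwards [(isOpen_lt (hu.sub (hw.div_const 2)) continuous_snd).mem_nhds h1,
    (isOpen_lt continuous_snd hu).mem_nhds h2] with w h3 h4
  refine param_eq ?_ h4.le
  rw [lower_eq_of_jump hα hk]
  have := mul_le_mul_of_nonneg_left (height_le_half (c := c) (t := w.1 - k))
    (weight_pos (w.1 - k)).le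
  have h3 : upper α c w.1 θ - weight (w.1 - k) / 2 < w.2 := h3
  linarith

theorem lower_zero (hα : Irrational α) :
    lower α c x 0 = upper α c x 0 - weight x * (1 - height c x) := by
  simpa using lower_eq_of_jump (c := c) (x := x) (θ := 0) hα (k := 0) (by simp)

theorem eq_lower_zero (hα : Irrational α) (hK : (x, y) ∈ closure (regular α c))
    (hp : param α c x y = 0) (hx : fract (x / c) ≠ 0) (hy : y < upper α c x 0) :
    y = lower α c x 0 := by
  refine le_antisymm (le_of_not_gt fun h => ?_) (hp ▸ lower_param_le x y)
  refine notMem_closure_regular (θ := 0) (k := 0) (by simp) ?_ hK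
  rw [lower_zero hα] at h
  have hu := (continuous_upper (α := α) (c := c) 0).comp (continuous_fst (X := ℝ) (Y := ℝ))
  have hw := (continuous_weight.comp (continuous_fst (X := ℝ) (Y := ℝ)))
  have hh : ContinuousAt (fun w : ℝ × ℝ => height c w.1) (x, y) :=
    ContinuousAt.comp (f := Prod.fst) (x := (x, y)) (continuousAt_height hx) continuousAt_fst
  filter_upwards [(hu.continuousAt.sub (hw.continuousAt.mul
    (continuousAt_const.sub hh))).eventually_lt continuousAt_snd h,
    (isOpen_lt continuous_snd hu).mem_nhds hy] with w h3 h4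
  refine param_eq ?_ h4.le
  rw [lower_zero hα]
  exact h3.le

theorem fract_div_ne_zero (hc : 0 < c) {n : ℤ} (h : x ∈ Ioo (n * c) ((n + 1 : ℤ) * c)) :
    fract (x / c) ≠ 0 := by
  intro h0
  obtain ⟨m, hm⟩ := Int.fract_eq_zero_iff.1 h0
  rw [eq_div_iff hc.ne'] at hm
  have h1 : n < m := by
    have := lt_of_mul_lt_mul_right (hm ▸ h.1) hc.le
    exact_mod_cast this
  have h2 : m < n + 1 := by
    have := lt_of_mul_lt_mul_right (hm ▸ h.2) hc.le
    exact_mod_cast this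
  lia

theorem exists_seq_height (hc : 0 < c) (n : ℤ) {v : ℝ} (h0 : 0 ≤ v) (h1 : v ≤ 1 / 2) :
    ∃ X : ℕ → ℝ, Tendsto X atTop (𝓝 ((n + 1 : ℤ) * c)) ∧
      (∀ j, X j ∈ Ioo (n * c) ((n + 1 : ℤ) * c)) ∧
      Tendsto (fun j => height c (X j)) atTop (𝓝 v) := by
  set A : ℕ → ℝ := fun j => Real.arcsin (4 * v - 1) + (j + 1 : ℕ) * (2 * Real.pi) with hA
  have hA1 : ∀ j, 1 < A j := fun j => by
    have h2 := Real.neg_pi_div_two_le_arcsin (4 * v - 1)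
    have h3 := Real.pi_gt_three
    have h4 : (0 : ℝ) ≤ j * (2 * Real.pi) := by positivity
    rw [hA]
    push_cast
    linarith
  have hsin : ∀ j, Real.sin (A j) = 4 * v - 1 := fun j => by
    rw [hA, Real.sin_add_nat_mul_two_pi, Real.sin_arcsin (by linarith) (by linarith)]
  have hlim : Tendsto (fun j => 1 - (A j)⁻¹) atTop (𝓝 1) := by
    have h2 : Tendsto A atTop atTop := tendsto_atTop_add_const_left _ _
      ((tendsto_natCast_atTop_atTop.comp (tendsto_add_atTop_nat 1)).atTop_mul_const
        Real.two_pi_pos)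
    simpa using (tendsto_inv_atTop_zero.comp h2).const_sub 1
  have hs : ∀ j, 1 - (A j)⁻¹ ∈ Ioo (0 : ℝ) 1 := fun j =>
    ⟨sub_pos.2 (inv_lt_one_of_one_lt₀ (hA1 j)), sub_lt_self _ (inv_pos.2 (by linarith [hA1 j]))⟩
  refine ⟨fun j => (n + (1 - (A j)⁻¹)) * c, ?_, fun j => ⟨?_, ?_⟩, ?_⟩
  · push_cast
    exact (hlim.const_add _).mul_const c
  · exact mul_lt_mul_of_pos_right (by linarith [(hs j).1]) hc
  · push_cast
    exact mul_lt_mul_of_pos_right (by linarith [(hs j).2]) hc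
  · have h2 : ∀ j, height c ((n + (1 - (A j)⁻¹)) * c) = (1 - (A j)⁻¹) * v := fun j => by
      rw [height, mul_div_cancel_right₀ _ hc.ne', Int.fract_intCast_add,
        Int.fract_eq_self.2 ⟨(hs j).1.le, (hs j).2⟩, wave, sub_sub_cancel, one_div, inv_inv, hsin]
      ring
    simpa [h2] using hlim.mul_const v

theorem height_eq_zero (hc : 0 < c) (n : ℤ) : height c (n * c) = 0 := by
  rw [height, mul_div_cancel_right₀ _ hc.ne', Int.fract_intCast, wave, zero_div, zero_mul]

theorem tendsto_lower_zero (hα : Irrational α) {X : ℕ → ℝ} {v : ℝ} (hX : Tendsto X atTop (𝓝 x))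
    (hv : Tendsto (fun j => height c (X j)) atTop (𝓝 v)) :
    Tendsto (fun j => (X j, lower α c (X j) 0)) atTop
      (𝓝 (x, upper α c x 0 - weight x * (1 - v))) := by
  refine hX.prodMk_nhds ?_
  simp only [lower_zero hα]
  exact (((continuous_upper 0).tendsto x).comp hX).sub
    (((continuous_weight.tendsto x).comp hX).mul (hv.const_sub 1))

theorem vertical_mem_closure_regular (hα : Irrational α) (hc : 0 < c) (n : ℤ)
    (h1 : lower α c (n * c) 0 ≤ y) (h2 : y ≤ upper α c (n * c) 0 - weight (n * c) / 2) :
    (n * c, y) ∈ closure (regular α c) := by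
  have hw := weight_pos (n * c)
  rw [lower_zero hα, height_eq_zero hc] at h1
  have h3 : (upper α c (n * c) 0 - y) / weight (n * c) ≤ 1 := (div_le_one hw).2 (by linarith)
  have h4 : 1 / 2 ≤ (upper α c (n * c) 0 - y) / weight (n * c) :=
    (le_div_iff₀ hw).2 (by linarith)
  obtain ⟨X, hX, -, hv⟩ := exists_seq_height hc (n - 1)
    (v := 1 - (upper α c (n * c) 0 - y) / weight (n * c)) (by linarith) (by linarith)
  rw [sub_add_cancel] at hX
  have := isClosed_closure.mem_of_tendsto (tendsto_lower_zero hα hX hv)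
    (Eventually.of_forall fun _ => lower_mem_closure_regular)
  rwa [sub_sub_cancel, mul_div_cancel₀ _ hw.ne', sub_sub_cancel] at this

/-! ### Paths in the minimal set -/

theorem lt_of_continuous_height (hc : 0 < c) (n : ℤ) {X H : unitInterval → ℝ} (hX : Continuous X)
    (hH : Continuous H) (h : ∀ t, fract (X t / c) ≠ 0 → H t = height c (X t))
    (h0 : X 0 < (n + 1 : ℤ) * c) (t : unitInterval) : X t < (n + 1 : ℤ) * c := by
  by_contra ht
  obtain ⟨τ, hτ, hmin⟩ := (isClosed_le continuous_const hX).isCompact.exists_isLeast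
    (s := {t | (n + 1 : ℤ) * c ≤ X t}) ⟨t, not_lt.1 ht⟩
  have hlt : ∀ s < τ, X s < (n + 1 : ℤ) * c := fun s hs =>
    lt_of_not_ge fun h => hs.not_ge (hmin h)
  have hpos : 0 < τ := lt_of_not_ge fun h => by
    rw [le_antisymm h unitInterval.nonneg'] at hτ
    exact h0.not_ge hτ
  have key : ∀ v : ℝ, 0 ≤ v → v ≤ 1 / 2 → H τ = v := by
    intro v hv0 hv1
    by_contra hne
    obtain ⟨U, V, hU, hV, hHU, hvV, hd⟩ := t2_separation hne
    obtain ⟨l, hl, hlU⟩ := exists_Ioc_subset_of_mem_nhds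
      (hH.continuousAt.preimage_mem_nhds (hU.mem_nhds hHU)) ⟨0, hpos⟩
    obtain ⟨s, hs1, hs2⟩ := exists_between hl
    obtain ⟨Y, hY, hYm, hYv⟩ := exists_seq_height hc n hv0 hv1
    obtain ⟨j, hj1, hj2⟩ := ((hY.eventually (lt_mem_nhds (hlt s hs2))).and
      (hYv.eventually (hV.mem_nhds hvV))).exists
    obtain ⟨r, hr, hrY⟩ := intermediate_value_Icc hs2.le hX.continuousOn
      ⟨hj1.le, (hYm j).2.le.trans hτ⟩
    refine disjoint_left.1 hd (hlU ⟨hs1.trans_le hr.1, hr.2⟩) ?_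
    rw [h r (hrY ▸ fract_div_ne_zero hc (hYm j)), hrY]
    exact hj2
  have h1 := key 0 le_rfl (by norm_num)
  have h2 := key (1 / 2) (by norm_num) le_rfl
  linarith

theorem le_of_continuous_height (hc : 0 < c) (n : ℤ) {X H : unitInterval → ℝ} (hX : Continuous X)
    (hH : Continuous H) (h : ∀ t, fract (X t / c) ≠ 0 → H t = height c (X t))
    (h0 : n * c ≤ X 0) (t : unitInterval) : n * c ≤ X t := by
  by_contra ht
  have hr : Continuous fun s : unitInterval => t * unitInterval.symm s := by fun_prop
  have := lt_of_continuous_height hc (n - 1) (hX.comp hr) (hH.comp hr) (fun s => h _)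
    (by simpa using ht) 1
  simp only [comp_apply, unitInterval.symm_one, mul_zero, sub_add_cancel] at this
  exact this.not_ge h0

theorem lt_upper_of_path (hα : Irrational α) {Γ : unitInterval → ℝ × ℝ} (hΓ : Continuous Γ)
    (hK : ∀ t, Γ t ∈ closure (regular α c)) {k : ℤ} (hk : fract (θ + k * α) = 0)
    {s : unitInterval} (hs : (Γ s).2 < upper α c (Γ s).1 θ) (t : unitInterval) :
    (Γ t).2 < upper α c (Γ t).1 θ := by
  by_contra ht
  have hw : ∀ t, 0 < weight ((Γ t).1 - k) := fun t => weight_pos _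
  have hg : Continuous fun t => (upper α c (Γ t).1 θ - (Γ t).2) / weight ((Γ t).1 - k) :=
    (((continuous_upper θ).comp (continuous_fst.comp hΓ)).sub (continuous_snd.comp hΓ)).div
      (continuous_weight.comp (by fun_prop)) fun t => (hw t).ne'
  have hne : ∀ t, (Γ t).2 < upper α c (Γ t).1 θ →
      1 / 2 ≤ (upper α c (Γ t).1 θ - (Γ t).2) / weight ((Γ t).1 - k) := fun t h1 => by
    rw [le_div_iff₀ (hw t)]
    by_contra h2
    exact notMem_closure_regular_of_lt hα hk (by linarith) h1 (hK t)
  have h1 := hne s hs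
  have h2 : (upper α c (Γ t).1 θ - (Γ t).2) / weight ((Γ t).1 - k) ≤ 0 :=
    div_nonpos_of_nonpos_of_nonneg (by linarith) (hw t).le
  obtain ⟨r, hr⟩ := mem_range_of_exists_le_of_exists_ge hg (c := 1 / 4) ⟨t, by linarith⟩
    ⟨s, by linarith⟩
  have h3 := hne r (by
    dsimp only at hr
    rw [div_eq_iff (hw r).ne'] at hr
    linarith [hw r])
  dsimp only at hr
  linarith

/-- The part of the lower leaf through the first jump which lies over one period, together with
the vertical segment attached to its left end. -/
def link (α c : ℝ) (n : ℤ) : Set (ℝ × ℝ) :=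
  {z | z ∈ closure (regular α c) ∧ param α c z.1 z.2 = 0 ∧ z.2 < upper α c z.1 0 ∧
    z.1 ∈ Ico (n * c) ((n + 1 : ℤ) * c)}

theorem param_eq_zero_of_path (hα : Irrational α) {Γ : unitInterval → ℝ × ℝ} (hΓ : Continuous Γ)
    (hK : ∀ t, Γ t ∈ closure (regular α c)) (h0 : param α c (Γ 0).1 (Γ 0).2 = 0)
    (h1 : (Γ 0).2 < upper α c (Γ 0).1 0) (t : unitInterval) :
    param α c (Γ t).1 (Γ t).2 = 0 := by
  refine le_antisymm (le_of_not_gt fun h => ?_) (le_of_not_gt fun h => ?_)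
  · exact (upper_le_of_lt_param h).not_gt
      (lt_upper_of_path hα hΓ hK (θ := 0) (k := 0) (by simp) h1 t)
  · obtain ⟨k, l, -, hkl⟩ := exists_nat_mul_near hα (param α c (Γ t).1 (Γ t).2 / 2)
      (ε := -param α c (Γ t).1 (Γ t).2 / 2) (by linarith) 0
    rw [abs_lt] at hkl
    have hj : fract ((l + k * α : ℝ) + (-k : ℤ) * α) = 0 :=
      Int.fract_eq_zero_iff.2 ⟨l, by push_cast; ring⟩
    have h2 := lt_upper_of_path hα hΓ hK hj (s := t)
      (lt_upper_of_param_lt (by linarith)) 0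
    exact h2.not_ge (upper_le_of_lt_param (by linarith))

theorem path_mem_link (hα : Irrational α) (hc : 0 < c) {n : ℤ} {Γ : unitInterval → ℝ × ℝ}
    (hΓ : Continuous Γ) (hK : ∀ t, Γ t ∈ closure (regular α c)) (h0 : Γ 0 ∈ link α c n)
    (t : unitInterval) : Γ t ∈ link α c n := by
  obtain ⟨-, hp, hu, h1, h2⟩ := h0
  have hp := param_eq_zero_of_path hα hΓ hK hp hu
  have hu := lt_upper_of_path hα hΓ hK (θ := 0) (k := 0) (by simp) hu
  have hX : Continuous fun t => (Γ t).1 := by fun_prop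
  have hH : Continuous fun t => 1 - (upper α c (Γ t).1 0 - (Γ t).2) / weight (Γ t).1 :=
    continuous_const.sub ((((continuous_upper 0).comp hX).sub (continuous_snd.comp hΓ)).div
      (continuous_weight.comp hX) fun t => (weight_pos _).ne')
  have h : ∀ t, fract ((Γ t).1 / c) ≠ 0 →
      1 - (upper α c (Γ t).1 0 - (Γ t).2) / weight (Γ t).1 = height c (Γ t).1 := fun t ht => by
    rw [eq_lower_zero hα (hK t) (hp t) ht (hu t), lower_zero hα, sub_sub_cancel,
      mul_div_cancel_left₀ _ (weight_pos _).ne', sub_sub_cancel]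
  exact ⟨hK t, hp t, hu t, le_of_continuous_height hc n hX hH h h1 t,
    lt_of_continuous_height hc n hX hH h h2 t⟩

theorem lower_zero_lt_upper (hα : Irrational α) : lower α c x 0 < upper α c x 0 := by
  rw [lower_zero hα]
  have := height_le_half (c := c) (t := x)
  exact sub_lt_self _ (mul_pos (weight_pos x) (by linarith))

theorem lower_mem_link (hα : Irrational α) {n : ℤ} (hx : x ∈ Ico (n * c) ((n + 1 : ℤ) * c)) :
    (x, lower α c x 0) ∈ link α c n :=
  ⟨lower_mem_closure_regular, param_lower, lower_zero_lt_upper hα, hx⟩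

theorem mul_mem_Ico (hc : 0 < c) (n : ℤ) : n * c ∈ Ico (n * c) ((n + 1 : ℤ) * c) :=
  left_mem_Ico.2 (mul_lt_mul_of_pos_right (by push_cast; linarith) hc)

theorem continuousOn_lower_zero (hα : Irrational α) (hc : 0 < c) (n : ℤ) :
    ContinuousOn (fun x => lower α c x 0) (Ico (n * c) ((n + 1 : ℤ) * c)) := by
  simp only [lower_zero hα]
  exact (continuous_upper 0).continuousOn.sub
    (continuous_weight.continuousOn.mul (continuousOn_const.sub (continuousOn_height hc n)))

theorem le_of_mem_closure_regular (hα : Irrational α) (hK : (x, y) ∈ closure (regular α c))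
    (hy : y < upper α c x 0) : y ≤ upper α c x 0 - weight x / 2 := by
  by_contra h
  exact notMem_closure_regular_of_lt hα (θ := 0) (k := 0) (by simp) (by simpa using h) hy hK

theorem joinedIn_link (hα : Irrational α) (hc : 0 < c) {n : ℤ} {z : ℝ × ℝ}
    (hz : z ∈ link α c n) : JoinedIn (link α c n) (n * c, lower α c (n * c) 0) z := by
  obtain ⟨x, y⟩ := z
  obtain ⟨hK, hp, hu, hx⟩ := hz
  dsimp only at hp hu hx
  rcases hx.1.eq_or_lt with rfl | h
  · have hl : lower α c (n * c) 0 ≤ y := hp ▸ lower_param_le _ _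
    have h1 : IsPathConnected ((fun y : ℝ => ((n * c : ℝ), y)) '' Icc (lower α c (n * c) 0) y) :=
      ((convex_Icc _ _).isPathConnected (nonempty_Icc.2 hl)).image (by fun_prop)
    refine (h1.joinedIn _ (mem_image_of_mem _ (left_mem_Icc.2 hl)) _
      (mem_image_of_mem _ (right_mem_Icc.2 hl))).mono ?_
    rintro _ ⟨v, hv, rfl⟩
    exact ⟨vertical_mem_closure_regular hα hc n hv.1
      (hv.2.trans (le_of_mem_closure_regular hα hK hu)), param_eq hv.1 (hv.2.trans hu.le),
      hv.2.trans_lt hu, hx⟩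
  · rw [eq_lower_zero hα hK hp (fract_div_ne_zero hc ⟨h, hx.2⟩) hu]
    have hs : Icc (n * c) x ⊆ Ico (n * c) ((n + 1 : ℤ) * c) := fun v hv =>
      ⟨hv.1, hv.2.trans_lt hx.2⟩
    have h1 : IsPathConnected ((fun v : ℝ => (v, lower α c v 0)) '' Icc (n * c) x) :=
      ((convex_Icc _ _).isPathConnected (nonempty_Icc.2 h.le)).image'
        (continuousOn_id.prodMk ((continuousOn_lower_zero hα hc n).mono hs))
    refine (h1.joinedIn _ (mem_image_of_mem _ (left_mem_Icc.2 h.le)) _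
      (mem_image_of_mem _ (right_mem_Icc.2 h.le))).mono ?_
    rintro _ ⟨v, hv, rfl⟩
    exact lower_mem_link hα (hs hv)

theorem eq_of_proj_eq (hα : Irrational α) {z w : ℝ × ℝ} (hz : param α c z.1 z.2 = 0)
    (hw : param α c w.1 w.2 = 0) (h : proj z = proj w) : z = w := by
  obtain ⟨k, l, rfl⟩ := proj_eq_proj_iff.1 h
  dsimp only at hw
  rw [param_deck hα, param_add_int hα, hz] at hw
  obtain rfl : 0 = k := jump_unique hα (θ := 0) (by simp)
    (Int.fract_eq_zero_iff.2 ⟨l, by linarith⟩)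
  obtain rfl : l = 0 := by
    simpa using hw
  simp

theorem link_disjoint (hc : 0 < c) {n m : ℤ} {z : ℝ × ℝ} (hn : z ∈ link α c n)
    (hm : z ∈ link α c m) : n = m := by
  have key : ∀ {n m : ℤ}, z ∈ link α c n → z ∈ link α c m → n ≤ m := fun hn hm => by
    have := lt_of_mul_lt_mul_right (hn.2.2.2.1.trans_lt hm.2.2.2.2) hc.le
    exact Int.lt_add_one_iff.1 (by exact_mod_cast this)
  exact le_antisymm (key hn hm) (key hm hn)

theorem exists_lift_of_path {γ : unitInterval → AddCircle (1 : ℝ) × AddCircle (1 : ℝ)}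
    (hγ : Continuous γ) {z : ℝ × ℝ} (h : γ 0 = proj z) :
    ∃ Γ : unitInterval → ℝ × ℝ, Continuous Γ ∧ (∀ t, proj (Γ t) = γ t) ∧ Γ 0 = z := by
  have hp : IsCoveringMap fun x : ℝ => (x : AddCircle (1 : ℝ)) := AddCircle.isCoveringMap_coe 1
  obtain ⟨Γ₁, h1, h1'⟩ := hp.exists_path_lifts ⟨fun t => (γ t).1, by fun_prop⟩ z.1
    (congrArg Prod.fst h)
  obtain ⟨Γ₂, h2, h2'⟩ := hp.exists_path_lifts ⟨fun t => (γ t).2, by fun_prop⟩ z.2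
    (congrArg Prod.snd h)
  exact ⟨fun t => (Γ₁ t, Γ₂ t), by fun_prop, fun t => Prod.ext (congrFun h1 t) (congrFun h2 t),
    Prod.ext h1' h2'⟩

/-- The image of a link in the minimal set. -/
def chain (α c : ℝ) (n : ℤ) : Set (minimalSet α c) :=
  {y | (y : AddCircle (1 : ℝ) × AddCircle (1 : ℝ)) ∈ proj '' link α c n}

theorem proj_image_link_subset (hα : Irrational α) (n : ℤ) :
    proj '' link α c n ⊆ minimalSet α c :=
  image_subset_iff.2 fun _ hz => (proj_mem_minimalSet hα).2 hz.1

theorem image_chain (hα : Irrational α) (n : ℤ) :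
    Subtype.val '' chain α c n = proj '' link α c n := by
  exact Subtype.image_preimage_val _ _ |>.trans (inter_eq_right.2 (proj_image_link_subset hα n))

theorem joined_chain_iff (hα : Irrational α) (hc : 0 < c) {n : ℤ} {p q : minimalSet α c}
    (hp : p ∈ chain α c n) : Joined p q ↔ q ∈ chain α c n := by
  obtain ⟨z, hz, hzp⟩ := hp
  constructor
  · rintro ⟨γ⟩
    obtain ⟨Γ, hΓ, hΓγ, h0⟩ := exists_lift_of_path (γ := fun t => (γ t).1) (by fun_prop) (z := z)
      (by simpa using hzp.symm)
    refine ⟨Γ 1, path_mem_link hα hc hΓ (fun t => ?_) (h0 ▸ hz) 1, by simpa using hΓγ 1⟩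
    rw [← proj_mem_minimalSet hα, hΓγ]
    exact (γ t).2
  · rintro ⟨w, hw, hwq⟩
    have h := ((((joinedIn_link hα hc hz).symm.trans (joinedIn_link hα hc hw)).map
      continuous_proj).mono (proj_image_link_subset hα n)).joined_subtype
    convert! h
    · exact hzp.symm
    · exact hwq.symm

theorem mem_link_right (hc : 0 < c) {n : ℤ} {z : ℝ × ℝ} (hK : z ∈ closure (regular α c))
    (hp : param α c z.1 z.2 = 0) (hu : z.2 < upper α c z.1 0) (hz : z.1 = (n + 1 : ℤ) * c) :
    z ∈ link α c (n + 1) :=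
  ⟨hK, hp, hu, hz ▸ mul_mem_Ico hc (n + 1)⟩

theorem closure_image_link (hα : Irrational α) (hc : 0 < c) (n : ℤ) :
    closure (proj '' link α c n) ⊆
      proj '' (link α c n ∪ {z ∈ link α c (n + 1) | z.1 = (n + 1 : ℤ) * c}) := by
  set C : Set (ℝ × ℝ) := {z | (z ∈ closure (regular α c) ∧ param α c z.1 z.2 = 0) ∧
    z.2 ≤ upper α c z.1 0 - weight z.1 / 2 ∧ z.1 ∈ Icc (n * c) ((n + 1 : ℤ) * c)} with hC
  have hu := (continuous_upper (α := α) (c := c) 0).comp (continuous_fst (X := ℝ) (Y := ℝ))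
  have hw := continuous_weight.comp (continuous_fst (X := ℝ) (Y := ℝ))
  have hcl : IsClosed C :=
    (isClosed_closure.inter (isClosed_eq continuous_param continuous_const)).inter
      ((isClosed_le continuous_snd (hu.sub (hw.div_const 2))).inter
        (isClosed_Icc.preimage continuous_fst))
  have hcomp : IsCompact C := by
    refine ((isCompact_Icc (a := n * c) (b := (n + 1 : ℤ) * c)).prod
      (isCompact_Icc (a := (0 : ℝ)) (b := 1))).image (f := fun p : ℝ × ℝ =>
        (p.1, upper α c p.1 0 - weight p.1 * p.2)) ?_ |>.of_isClosed_subset hcl ?_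
    · exact continuous_fst.prodMk (hu.sub (hw.mul continuous_snd))
    · rintro ⟨x, y⟩ ⟨⟨-, hp⟩, hy, hx⟩
      have hw := weight_pos x
      have hl : lower α c x 0 ≤ y := (show param α c x y = 0 from hp) ▸ lower_param_le x y
      rw [lower_zero hα] at hl
      have := mul_nonneg hw.le (height_nonneg (c := c) (t := x))
      dsimp only at hy
      refine ⟨(x, (upper α c x 0 - y) / weight x), ⟨hx, div_nonneg (by linarith) hw.le,
        (div_le_one hw).2 (by linarith)⟩, ?_⟩
      simp only [mul_div_cancel₀ _ hw.ne', sub_sub_cancel]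
  refine (closure_minimal (image_mono fun z hz => ?_)
    (hcomp.image continuous_proj).isClosed).trans (image_mono fun z hz => ?_)
  · exact ⟨⟨hz.1, hz.2.1⟩, le_of_mem_closure_regular hα hz.1 hz.2.2.1, hz.2.2.2.1, hz.2.2.2.2.le⟩
  · have hu : z.2 < upper α c z.1 0 := hz.2.1.trans_lt (by linarith [weight_pos z.1])
    rcases hz.2.2.2.lt_or_eq with h | h
    · exact Or.inl ⟨hz.1.1, hz.1.2, hu, hz.2.2.1, h⟩
    · exact Or.inr ⟨mem_link_right hc hz.1.1 hz.1.2 hu h, h⟩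

theorem right_mem_closure_image_link (hα : Irrational α) (hc : 0 < c) (n : ℤ) :
    proj ((n + 1 : ℤ) * c, lower α c ((n + 1 : ℤ) * c) 0) ∈ closure (proj '' link α c n) := by
  obtain ⟨X, hX, hXm, hv⟩ := exists_seq_height hc n (v := 0) le_rfl (by norm_num)
  have := tendsto_lower_zero hα hX hv
  rw [lower_zero hα, height_eq_zero hc]
  exact mem_closure_of_tendsto ((continuous_proj.tendsto _).comp this)
    (Eventually.of_forall fun j => mem_image_of_mem _
      (lower_mem_link hα (Ioo_subset_Ico_self (hXm j))))

theorem mem_link_floor (hc : 0 < c) {z : ℝ × ℝ} (hK : z ∈ closure (regular α c))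
    (hp : param α c z.1 z.2 = 0) (hu : z.2 < upper α c z.1 0) : z ∈ link α c ⌊z.1 / c⌋ := by
  refine ⟨hK, hp, hu, (le_div_iff₀ hc).1 (Int.floor_le _), (div_lt_iff₀ hc).1 ?_⟩
  push_cast
  exact Int.lt_floor_add_one _

theorem exists_eq_proj_upper (hα : Irrational α) (hc : 0 < c) {p : minimalSet α c}
    (hp : ∀ n, p ∉ chain α c n) :
    ∃ x θ, (p : AddCircle (1 : ℝ) × AddCircle (1 : ℝ)) = proj (x, upper α c x θ) := by
  obtain ⟨⟨x, y⟩, hz⟩ := isOpenQuotientMap_proj.surjective p.1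
  refine ⟨x, param α c x y, ?_⟩
  rw [← hz]
  by_contra hne
  have hlt : y < upper α c x (param α c x y) :=
    (le_upper_param x y).lt_of_ne fun h => hne (by rw [← h])
  obtain ⟨k, hk⟩ : ∃ k : ℤ, fract (param α c x y + k * α) = 0 := by
    by_contra! h
    exact hlt.not_ge (lower_eq_upper h ▸ lower_param_le x y)
  obtain ⟨l, hl⟩ := Int.fract_eq_zero_iff.1 hk
  have hz' : proj (x + (-k : ℤ), y + (-l : ℤ)) = p.1 := by
    rw [← hz, eq_comm, proj_eq_proj_iff]
    exact ⟨_, _, rfl⟩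
  have h1 : param α c (x + (-k : ℤ)) (y + (-l : ℤ)) = 0 := by
    rw [param_deck hα, param_add_int hα]
    push_cast
    linarith
  have h2 : upper α c (x + (-k : ℤ)) 0 + l = upper α c x (param α c x y) := by
    rw [← upper_add_int, ← upper_deck (-k) (x := x)]
    congr 1
    push_cast
    linarith
  refine hp _ ⟨_, mem_link_floor hc ?_ h1 ?_, hz'⟩
  · rw [← proj_mem_minimalSet hα, hz']
    exact p.2
  · push_cast at h2 ⊢
    linarith

theorem dense_pathComponent (hα : Irrational α) (hc : 0 < c) (hs : Spreading α c)
    {p : minimalSet α c} (hp : ∀ n, p ∉ chain α c n) : Dense (pathComponent p) := by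
  obtain ⟨x, θ, hx⟩ := exists_eq_proj_upper hα hc hp
  refine (dense_flow_orbit hα hc hs p).mono ?_
  rintro q ⟨n, hq⟩
  rw [hx, flow_proj, slide_upper hα hc] at hq
  have h : IsPathConnected (range fun x => proj (x, upper α c x θ)) :=
    isPathConnected_range (continuous_proj.comp (continuous_id.prodMk (continuous_upper θ)))
  have h1 := ((h.joinedIn _ (mem_range_self x) 
    _ (mem_range_self (x + (n + 1 : ℕ) * c))).mono
    (V := minimalSet α c) (range_subset_iff.2 fun x =>
      (proj_mem_minimalSet hα).2 upper_mem_closure_regular)).joined_subtype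
  rw [mem_pathComponent_iff]
  convert! h1

theorem pathChain_minimalSet (hα : Irrational α) (hc : 0 < c) (hs : Spreading α c) :
    PathChain (minimalSet α c) (chain α c) (fun p => p.1.1) c where
  nonempty n := ⟨⟨_, proj_image_link_subset hα n (mem_image_of_mem _
    (lower_mem_link hα (mul_mem_Ico hc n)))⟩, mem_image_of_mem _
    (lower_mem_link hα (mul_mem_Ico hc n))⟩
  joined_iff n p q hp := joined_chain_iff hα hc hp
  disjoint n m p hn hm := by
    obtain ⟨z, hz, hzp⟩ := hn
    obtain ⟨w, hw, hwp⟩ := hm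
    obtain rfl := eq_of_proj_eq hα hz.2.1 hw.2.1 (hzp.trans hwp.symm)
    exact link_disjoint hc hz hw
  closure_subset n p hp := by
    rw [closure_subtype, image_chain hα] at hp
    obtain ⟨z, hz | hz, hzp⟩ := closure_image_link hα hc n hp
    · exact Or.inl ⟨z, hz, hzp⟩
    · exact Or.inr ⟨z, hz.1, hzp⟩
  closure_meets n := by
    have h := mem_image_of_mem proj (lower_mem_link hα (mul_mem_Ico hc (n + 1)))
    refine ⟨⟨_, proj_image_link_subset hα _ h⟩, ?_, h⟩
    rw [closure_subtype, image_chain hα]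
    exact right_mem_closure_image_link hα hc n
  dense p hp := dense_pathComponent hα hc hs hp
  continuous := by fun_prop
  surjective a := by
    obtain ⟨x, rfl⟩ := QuotientAddGroup.mk_surjective a
    exact ⟨⟨proj (x, upper α c x 0), (proj_mem_minimalSet hα).2 upper_mem_closure_regular⟩, rfl⟩
  apply_eq n p hp hp' := by
    rw [closure_subtype, image_chain hα] at hp
    obtain ⟨w, hw, hwp⟩ := hp'
    obtain ⟨z, hz, hzp⟩ := closure_image_link hα hc n hp
    have h : param α c z.1 z.2 = 0 := by
      rcases hz with hz | hz
      exacts [hz.2.1, hz.1.2.1]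
    obtain rfl := eq_of_proj_eq hα h hw.2.1 (hzp.trans hwp.symm)
    rcases hz with hz | hz
    · have := link_disjoint hc hz hw
      lia
    · rw [← hzp, ← hz.2]
      rfl

end Denjoy

/-- There exist a homeomorphism `φ` of the 2-torus homotopic to the identity and a
nonempty closed invariant set `Y` on which `φ` restricts to a minimal homeomorphism,
while `Y × Y` admits no minimal homeomorphism. -/
theorem stmt2 :
    ∃ (φ : (AddCircle (1 : ℝ) × AddCircle (1 : ℝ)) ≃ₜ (AddCircle (1 : ℝ) × AddCircle (1 : ℝ))),
      ContinuousMap.Homotopic ⟨(φ : _ → _), φ.continuous⟩ (ContinuousMap.id _) ∧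
      ∃ Y : Set (AddCircle (1 : ℝ) × AddCircle (1 : ℝ)),
        Y.Nonempty ∧ IsClosed Y ∧ φ '' Y = Y ∧
        (∃ ψ : Y ≃ₜ Y, (∀ y : Y, (ψ y : AddCircle (1 : ℝ) × AddCircle (1 : ℝ)) = φ y) ∧
          IsMinimalMap (ψ : Y → Y)) ∧
        ¬ AdmitsMinimalHomeo (Y × Y) := by
  obtain ⟨c, hc, hs⟩ := Denjoy.exists_spreading irrational_sqrt_two
  refine ⟨Denjoy.flowHomeomorph irrational_sqrt_two hc,
    Denjoy.flowHomeomorph_homotopic irrational_sqrt_two hc, Denjoy.minimalSet √2 c,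
    ⟨_, (Denjoy.proj_mem_minimalSet irrational_sqrt_two).2
      (Denjoy.upper_mem_closure_regular (x := 0) (θ := 0))⟩, isClosed_closure,
    Denjoy.image_minimalSet irrational_sqrt_two hc,
    ⟨_, fun _ => rfl, Denjoy.isMinimalMap_minimalSet irrational_sqrt_two hc hs⟩,
    (Denjoy.pathChain_minimalSet irrational_sqrt_two hc hs).not_minimalHomeo_prod⟩
end

section
/- Let M be a nonempty compact metric space that admits a topological embedding into ℝ^d for some d ∈ ℕ, and let φ : M × ℝ → M be a continuous, aperiodic, minimal flow. Then there exists a residual subset A ⊆ ℝ such that for every c ∈ A there exist a continuous surjection f : M → M which is minimal and not injective, and an almost 1-1 factor map π : (M, f) → (M, h_c), where h_c : M → M is the time-c map h_c(x) = φ(x, c). -/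
open Function Set Topology Filter Metric

/-- `φ` is a continuous flow. -/
def IsFlow {M : Type*} [TopologicalSpace M] (φ : M → ℝ → M) : Prop :=
  Continuous (fun p : M × ℝ => φ p.1 p.2) ∧ (∀ x, φ x 0 = x) ∧
    ∀ x s t, φ (φ x s) t = φ x (s + t)

/-- The distance from `p` to the piece `{φ y t | t ∈ K}` of the orbit of `y`. -/
noncomputable def orbitDist {M : Type*} [MetricSpace M] (φ : M → ℝ → M) (p : M) (K : Set ℝ)
    (y : M) : ℝ :=
  sInf ((fun t => dist (φ y t) p) '' K)

/-- Algebraic form of the monotonicity of `(A - B) / (A + B)` in `A` and of its antitonicity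
in `B`. -/
lemma ratio_le_ratio {A B A' B' ρ ρ' : ℝ} (hA : 0 ≤ A) (hB' : 0 ≤ B') (hAA : A ≤ A')
    (hBB : B' ≤ B) (hpos : 0 < A + B ∨ 0 < A' + B') (hρ1 : ρ ≤ 1) (hρ' : -1 ≤ ρ')
    (hρ : ρ * (A + B) = A - B) (hρ'' : ρ' * (A' + B') = A' - B') : ρ ≤ ρ' := by
  by_contra! hlt
  have h1 : (1 + ρ) * B = (1 - ρ) * A := by linarith
  have h2 : (1 + ρ') * B' = (1 - ρ') * A' := by linarith
  have h3 : (1 - ρ') * A ≤ (1 - ρ') * A' := mul_le_mul_of_nonneg_left hAA (by linarith)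
  have h4 : (1 + ρ') * B' ≤ (1 + ρ') * B := mul_le_mul_of_nonneg_left hBB (by linarith)
  have h5 : (ρ - ρ') * (A + B) ≤ 0 := by linarith
  have h6 : A + B ≤ 0 := nonpos_of_mul_nonpos_right h5 (by linarith)
  have h7 : 0 < A' + B' := hpos.resolve_left (by linarith)
  have h8 : B' = 0 := by linarith
  rw [h8] at h2 h7
  have : 0 < (1 - ρ') * A' := mul_pos (by linarith) (by linarith)
  linarith

namespace IsFlow

section

variable {M : Type*} [MetricSpace M] {φ : M → ℝ → M}

lemma continuous_comp (hφ : IsFlow φ) {X : Type*} [TopologicalSpace X] {g : X → M} {t : X → ℝ}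
    (hg : Continuous g) (ht : Continuous t) : Continuous fun x => φ (g x) (t x) :=
  hφ.1.comp (hg.prodMk ht)

lemma iterate_time (hφ : IsFlow φ) (c : ℝ) (n : ℕ) (x : M) :
    (fun y => φ y c)^[n] x = φ x (n * c) := by
  induction n with
  | zero => simp [hφ.2.1]
  | succ n ih =>
    rw [Function.iterate_succ_apply', ih, hφ.2.2]
    push_cast
    ring_nf

lemma orbitDist_le (φ : M → ℝ → M) (p y : M) {K : Set ℝ} {t : ℝ} (ht : t ∈ K) :
    orbitDist φ p K y ≤ dist (φ y t) p :=
  csInf_le ⟨0, by rintro _ ⟨s, -, rfl⟩; exact dist_nonneg⟩ ⟨t, ht, rfl⟩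

lemma orbitDist_nonneg (φ : M → ℝ → M) (p y : M) (K : Set ℝ) : 0 ≤ orbitDist φ p K y :=
  Real.sInf_nonneg (by rintro _ ⟨s, -, rfl⟩; exact dist_nonneg)

lemma continuous_orbitDist (hφ : IsFlow φ) (p : M) {K : Set ℝ} (hK : IsCompact K) :
    Continuous (orbitDist φ p K) :=
  hK.continuous_sInf (f := fun y t => dist (φ y t) p) (hφ.1.dist continuous_const)

lemma exists_orbitDist_eq (hφ : IsFlow φ) (p y : M) {K : Set ℝ} (hK : IsCompact K)
    (hne : K.Nonempty) : ∃ t ∈ K, orbitDist φ p K y = dist (φ y t) p :=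
  hK.exists_sInf_image_eq hne
    ((hφ.continuous_comp continuous_const continuous_id).dist continuous_const).continuousOn

lemma orbitDist_le_orbitDist (hφ : IsFlow φ) (p : M) {y y' : M} {K K' : Set ℝ}
    (hK' : IsCompact K') (hne : K'.Nonempty)
    (h : ∀ t ∈ K', ∃ s ∈ K, dist (φ y s) p ≤ dist (φ y' t) p) :
    orbitDist φ p K y ≤ orbitDist φ p K' y' := by
  obtain ⟨t, ht, hteq⟩ := hφ.exists_orbitDist_eq p y' hK' hne
  obtain ⟨s, hs, hst⟩ := h t ht
  exact hteq ▸ (orbitDist_le φ p y hs).trans hst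

/-- Orbit pieces starting close to `p` do not come back immediately. -/
lemma exists_no_return (hφ : IsFlow φ) (haper : ∀ x : M, ∀ t : ℝ, φ x t = x → t = 0) (p : M) :
    ∃ ε > 0, ∀ z, dist z p < ε → ∀ s : ℝ, 1 / 2 ≤ |s| → |s| ≤ 2 → ε ≤ dist (φ z s) p := by
  have hK : IsCompact (Icc (-2 : ℝ) (-1 / 2) ∪ Icc (1 / 2 : ℝ) 2) :=
    isCompact_Icc.union isCompact_Icc
  set K := Icc (-2 : ℝ) (-1 / 2) ∪ Icc (1 / 2 : ℝ) 2
  have hpos : 0 < orbitDist φ p K p := by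
    obtain ⟨t, ht, hteq⟩ := hφ.exists_orbitDist_eq p p hK ⟨1, Or.inr (by norm_num)⟩
    rw [hteq, dist_pos]
    intro h
    rw [haper _ _ h] at ht
    rcases ht with ht | ht <;> norm_num at ht
  have hev : ∀ᶠ z in 𝓝 p, orbitDist φ p K p / 2 < orbitDist φ p K z :=
    (hφ.continuous_orbitDist p hK).continuousAt.eventually_const_lt (half_lt_self hpos)
  obtain ⟨ε, hε, hball⟩ := Metric.eventually_nhds_iff.1 hev
  refine ⟨min ε (orbitDist φ p K p / 2), lt_min hε (half_pos hpos), fun z hz s hs1 hs2 => ?_⟩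
  refine (min_le_right _ _).trans ((hball (hz.trans_le (min_le_left _ _))).le.trans ?_)
  refine orbitDist_le φ p z ?_
  rw [abs_le] at hs2
  rcases le_abs'.1 hs1 with h | h
  · exact Or.inl ⟨hs2.1, by linarith⟩
  · exact Or.inr ⟨h, hs2.2⟩

variable [CompactSpace M]

/-- Every half-orbit of a minimal flow on a compact space visits every open set infinitely often. -/
lemma frequently_mem (hφ : IsFlow φ) (hmin : ∀ x : M, Dense (range (φ x))) {c : ℝ} (hc : c ≠ 0)
    (x : M) {V : Set M} (hV : IsOpen V) (hne : V.Nonempty) :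
    ∃ᶠ u : ℝ in atTop, φ x (c * u) ∈ V := by
  obtain ⟨y, hy⟩ := exists_clusterPt_of_compactSpace (map (fun u : ℝ => φ x (c * u)) atTop)
  obtain ⟨_, hs, s, rfl⟩ := (hmin y).inter_open_nonempty V hV hne
  have hW : ∀ᶠ z in 𝓝 y, φ z s ∈ V :=
    (hφ.continuous_comp continuous_id continuous_const).continuousAt.eventually
      (hV.mem_nhds hs)
  have h1 : ∃ᶠ u : ℝ in atTop, φ (φ x (c * u)) s ∈ V :=
    (mapClusterPt_iff_frequently.1 hy) _ hW
  have h2 : Tendsto (fun u : ℝ => u + s / c) atTop atTop :=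
    tendsto_atTop_add_const_right _ _ tendsto_id
  refine h2.frequently (h1.mono fun u hu => ?_)
  rw [hφ.2.2] at hu
  rwa [mul_add, mul_div_cancel₀ _ hc]

/-- For a residual set of times `c`, the forward orbit of `x` under the time-`c` map is dense. -/
lemma residual_dense_time_orbit (hφ : IsFlow φ) (hmin : ∀ x : M, Dense (range (φ x))) (x : M) :
    {c : ℝ | c ≠ 0 ∧ Dense (range fun n : ℕ => φ x ((n + 1 : ℕ) * c))} ∈ residual ℝ := by
  have h0 : {c : ℝ | c ≠ 0} ∈ residual ℝ :=
    residual_of_dense_open isOpen_ne (dense_compl_singleton 0)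
  have hB := TopologicalSpace.isBasis_countableBasis M
  have key : ∀ V ∈ TopologicalSpace.countableBasis M,
      {c : ℝ | ∃ n : ℕ, φ x ((n + 1 : ℕ) * c) ∈ V} ∈ residual ℝ := by
    intro V hVB
    have hV := hB.isOpen hVB
    have hne := TopologicalSpace.nonempty_of_mem_countableBasis hVB
    refine residual_of_dense_open ?_ ?_
    · simp only [ofPred_exists]
      exact isOpen_iUnion fun n =>
        hV.preimage (hφ.continuous_comp continuous_const (by fun_prop))
    · have hd : Dense {c : ℝ | c ≠ 0} := dense_compl_singleton 0
      rw [← dense_closure]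
      refine hd.mono fun c hc => ?_
      rw [mem_closure_iff_nhds]
      intro J hJ
      have ht : Tendsto (fun u : ℝ => c * ((⌈u⌉₊ : ℝ) / u)⁻¹) atTop (𝓝 (c * 1⁻¹)) :=
        (tendsto_nat_ceil_div_atTop.inv₀ one_ne_zero).const_mul c
      rw [inv_one, mul_one] at ht
      obtain ⟨u, hu, huJ, hu0⟩ := ((hφ.frequently_mem hmin hc x hV hne).and_eventually
        ((ht.eventually hJ).and (eventually_gt_atTop 0))).exists
      refine ⟨_, huJ, ⌈u⌉₊ - 1, ?_⟩
      have hpos : 0 < ⌈u⌉₊ := Nat.ceil_pos.2 hu0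
      rw [Nat.sub_add_cancel hpos]
      convert hu using 2
      have : (⌈u⌉₊ : ℝ) ≠ 0 := by exact_mod_cast hpos.ne'
      field_simp
  have h1 := (countable_bInter_mem (TopologicalSpace.countable_countableBasis M)).2 key
  filter_upwards [h0, h1] with c hc hc1
  refine ⟨hc, hB.dense_iff.2 fun V hV _ => ?_⟩
  obtain ⟨n, hn⟩ := mem_iInter₂.1 hc1 V hV
  exact ⟨_, hn, n, rfl⟩

/-- If one point has a dense forward orbit under the time-`c` map of a minimal flow, then this map
is minimal. -/
lemma isMinimalMap_time (hφ : IsFlow φ) (hmin : ∀ x : M, Dense (range (φ x))) {c : ℝ}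
    (hc : c ≠ 0) {x₀ : M} (hx₀ : Dense (range fun n : ℕ => φ x₀ ((n + 1 : ℕ) * c))) :
    IsMinimalMap fun x => φ x c := by
  refine ⟨hφ.continuous_comp continuous_id continuous_const, fun x => ?_⟩
  simp only [hφ.iterate_time]
  set K := closure (range fun n : ℕ => φ x ((n + 1 : ℕ) * c)) with hK
  have hKc : IsClosed K := isClosed_closure
  have hstep : ∀ y ∈ K, φ y c ∈ K := by
    intro y hy
    refine map_mem_closure (f := fun y => φ y c)
      (hφ.continuous_comp continuous_id continuous_const) hy ?_
    rintro _ ⟨n, rfl⟩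
    refine ⟨n + 1, ?_⟩
    simp only [hφ.2.2]
    push_cast
    ring_nf
  have hiter : ∀ n : ℕ, ∀ y ∈ K, φ y (n * c) ∈ K := by
    intro n y hy
    rw [← hφ.iterate_time]
    exact (show MapsTo (fun y => φ y c) K K from hstep).iterate n hy
  set Z := (fun p : M × ℝ => φ p.1 (c * p.2)) '' (K ×ˢ Icc 0 1)
  have hZc : IsClosed Z :=
    ((hKc.isCompact.prod isCompact_Icc).image
      (hφ.continuous_comp continuous_fst (by fun_prop))).isClosed
  have hZfwd : ∀ z ∈ Z, ∀ u : ℝ, 0 ≤ u → φ z (c * u) ∈ Z := by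
    rintro _ ⟨⟨y, t⟩, ⟨hy, ht⟩, rfl⟩ u hu
    have h0 : 0 ≤ t + u := add_nonneg ht.1 hu
    refine ⟨(φ y (⌊t + u⌋₊ * c), t + u - ⌊t + u⌋₊), ⟨hiter _ _ hy, ?_, ?_⟩, ?_⟩
    · exact sub_nonneg.2 (Nat.floor_le h0)
    · have := Nat.lt_floor_add_one (t + u)
      simp only
      linarith
    · simp only [hφ.2.2]
      ring_nf
  have hxK : φ x ((0 + 1 : ℕ) * c) ∈ K := subset_closure ⟨0, rfl⟩
  have hZuniv : x₀ ∈ Z := by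
    have hzZ : φ x ((0 + 1 : ℕ) * c) ∈ Z :=
      ⟨(_, 0), ⟨hxK, by simp⟩, by simp [hφ.2.1]⟩
    by_contra hx
    obtain ⟨u, hu, hu0⟩ := ((hφ.frequently_mem hmin hc (φ x ((0 + 1 : ℕ) * c)) hZc.isOpen_compl
      ⟨x₀, hx⟩).and_eventually (eventually_ge_atTop 0)).exists
    exact hu (hZfwd _ hzZ u hu0)
  obtain ⟨⟨y, t⟩, ⟨hy, -⟩, hyt⟩ := hZuniv
  simp only at hy hyt
  have hclosed : IsClosed ((fun z => φ z (-(c * t))) ⁻¹' K) :=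
    hKc.preimage (hφ.continuous_comp continuous_id continuous_const)
  have hall : (fun z => φ z (-(c * t))) ⁻¹' K = univ := by
    refine (hx₀.mono ?_).closure_eq ▸ hclosed.closure_eq.symm
    rintro _ ⟨n, rfl⟩
    have := hiter (n + 1) y hy
    simp only [mem_preimage, ← hyt, hφ.2.2]
    convert this using 2
    ring
  rw [dense_iff_closure_eq, ← hK, eq_univ_iff_forall]
  intro z
  have : φ z (c * t) ∈ (fun z => φ z (-(c * t))) ⁻¹' K := hall ▸ mem_univ _
  simpa [hφ.2.2, hφ.2.1] using this

/-- The complement of every orbit of an aperiodic minimal flow is dense. -/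
lemma dense_compl_orbit (hφ : IsFlow φ) (hmin : ∀ x : M, Dense (range (φ x)))
    (haper : ∀ x : M, ∀ t : ℝ, φ x t = x → t = 0) (p : M) : Dense (range (φ p))ᶜ := by
  have hseg : ∀ n : ℕ, IsCompact (φ p '' Icc (-n : ℝ) n) := fun n =>
    isCompact_Icc.image (hφ.continuous_comp continuous_const continuous_id)
  have hempty : ∀ n : ℕ, interior (φ p '' Icc (-n : ℝ) n) = ∅ := by
    intro n
    by_contra hne
    rw [← ne_eq, ← nonempty_iff_ne_empty] at hne
    obtain ⟨T, hT⟩ := isCompact_univ.elim_finite_subcover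
      (fun t : ℝ => (fun z => φ z t) ⁻¹' interior (φ p '' Icc (-n : ℝ) n))
      (fun t => isOpen_interior.preimage (hφ.continuous_comp continuous_id continuous_const))
      (fun x _ => by
        obtain ⟨_, hs, s, rfl⟩ := (hmin x).inter_open_nonempty _ isOpen_interior hne
        exact mem_iUnion.2 ⟨s, hs⟩)
    obtain ⟨R, hR⟩ := T.finite_toSet.bddBelow
    have hx := hT (mem_univ (φ p (n - R + 1)))
    obtain ⟨t, ht, hxt⟩ := mem_iUnion₂.1 hx
    obtain ⟨s, hs, hst⟩ := interior_subset hxt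
    have hRt : R ≤ t := hR ht
    have h1 : φ (φ p s) (n - R + 1 + t - s) = φ p s := by
      conv_rhs => rw [hst]
      simp only [hφ.2.2]
      ring_nf
    have := haper _ _ h1
    linarith [hs.2]
  have hU : (range (φ p))ᶜ = ⋂ n : ℕ, (φ p '' Icc (-n : ℝ) n)ᶜ := by
    rw [← compl_iUnion, ← image_iUnion, ← image_univ]
    congr 2
    refine (eq_univ_of_forall fun t => mem_iUnion.2 ?_).symm
    obtain ⟨n, hn⟩ := exists_nat_ge |t|
    exact ⟨n, abs_le.1 hn⟩
  rw [hU]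
  refine dense_iInter_of_isOpen (fun n => (hseg n).isClosed.isOpen_compl) fun n => ?_
  rw [← interior_eq_empty_iff_dense_compl]
  exact hempty n

/-- A cutoff function near `p` which is Lipschitz along the flow. -/
lemma exists_cutoff (hφ : IsFlow φ) (p : M) {ε : ℝ} (hε : 0 < ε) :
    ∃ χ : M → ℝ, Continuous χ ∧ (∀ y, 0 ≤ χ y) ∧ (∀ y, χ y ≤ 1) ∧ 0 < χ p ∧
      (∀ y, χ y ≠ 0 → dist y p < ε) ∧ ∀ y r, 0 ≤ r → |χ (φ y r) - χ y| ≤ 2 * r := by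
  have hτ : ∀ᶠ t in 𝓝 (0 : ℝ), ∀ z ∈ (univ : Set M), dist (φ z t) z < ε / 2 := by
    refine isCompact_univ.eventually_forall_of_forall_eventually fun z _ => ?_
    have hc : Continuous fun q : ℝ × M => dist (φ q.2 q.1) q.2 :=
      (hφ.continuous_comp continuous_snd continuous_fst).dist continuous_snd
    refine hc.continuousAt.eventually_lt_const ?_
    simpa [hφ.2.1] using half_pos hε
  obtain ⟨τ₀, hτ₀, hball⟩ := Metric.eventually_nhds_iff.1 hτ
  set τ := min 1 (τ₀ / 2)
  have hτpos : 0 < τ := lt_min one_pos (half_pos hτ₀)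
  have hτ1 : τ ≤ 1 := min_le_left _ _
  have hmove : ∀ z, ∀ t ∈ Icc 0 τ, dist (φ z t) z < ε / 2 := by
    intro z t ht
    refine hball ?_ z (mem_univ z)
    rw [Real.dist_eq, sub_zero, abs_of_nonneg ht.1]
    have := min_le_right 1 (τ₀ / 2)
    linarith [ht.2]
  set χ₀ : M → ℝ := fun z => max 0 (1 - 2 / ε * dist z p) with hχ₀
  have hχ₀c : Continuous χ₀ := by fun_prop
  have hχ₀0 : ∀ z, 0 ≤ χ₀ z := fun z => le_max_left _ _
  have hχ₀1 : ∀ z, χ₀ z ≤ 1 := fun z =>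
    max_le zero_le_one (sub_le_self _ (mul_nonneg (by positivity) dist_nonneg))
  have hχ₀pos : ∀ z, dist z p < ε / 2 ↔ 0 < χ₀ z := by
    intro z
    simp only [hχ₀, lt_max_iff, lt_irrefl, false_or, sub_pos]
    rw [div_mul_eq_mul_div, div_lt_one hε, lt_div_iff₀ two_pos, mul_comm]
  have hcont : ∀ y, Continuous fun t => χ₀ (φ y t) := fun y =>
    hχ₀c.comp (hφ.continuous_comp continuous_const continuous_id)
  have hintg : ∀ y a b, IntervalIntegrable (fun t => χ₀ (φ y t)) MeasureTheory.volume a b :=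
    fun y a b => (hcont y).intervalIntegrable a b
  have hle : ∀ y a b, a ≤ b → ∫ t in a..b, χ₀ (φ y t) ≤ b - a := by
    intro y a b hab
    have := intervalIntegral.integral_mono_on hab (hintg y a b)
      (intervalIntegrable_const (c := (1 : ℝ))) fun t _ => hχ₀1 _
    simpa using this
  have hge : ∀ y a b, a ≤ b → 0 ≤ ∫ t in a..b, χ₀ (φ y t) := fun y a b hab =>
    intervalIntegral.integral_nonneg hab fun t _ => hχ₀0 _
  refine ⟨fun y => ∫ t in (0 : ℝ)..τ, χ₀ (φ y t), ?_, fun y => hge y _ _ hτpos.le,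
    fun y => (hle y _ _ hτpos.le).trans (by linarith), ?_, ?_, ?_⟩
  · exact intervalIntegral.continuous_parametric_intervalIntegral_of_continuous'
      (f := fun y t => χ₀ (φ y t)) (hχ₀c.comp hφ.1) 0 τ
  · refine intervalIntegral.intervalIntegral_pos_of_pos_on (hintg p _ _) (fun t ht => ?_) hτpos
    exact (hχ₀pos _).1 (hmove p t (Ioo_subset_Icc_self ht))
  · intro y hy
    by_contra! hd
    refine hy ?_
    refine (intervalIntegral.integral_congr (g := fun _ => (0 : ℝ)) fun t ht => ?_).trans
      intervalIntegral.integral_zero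
    rw [uIcc_of_le hτpos.le] at ht
    refine le_antisymm (not_lt.1 fun h => ?_) (hχ₀0 _)
    have h1 := (hχ₀pos _).2 h
    have h2 := hmove y t ht
    have h3 := dist_triangle_left y p (φ y t)
    linarith
  · intro y r hr
    have h1 : ∫ t in (0 : ℝ)..τ, χ₀ (φ (φ y r) t) = ∫ t in r..(r + τ), χ₀ (φ y t) := by
      simp only [hφ.2.2]
      rw [intervalIntegral.integral_comp_add_left (fun t => χ₀ (φ y t)) r, add_zero]
    have h2 := intervalIntegral.integral_add_adjacent_intervals (hintg y 0 r) (hintg y r (r + τ))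
    have h3 := intervalIntegral.integral_add_adjacent_intervals (hintg y 0 τ) (hintg y τ (r + τ))
    have h4 := hle y 0 r hr
    have h5 := hge y 0 r hr
    have h6 := hle y τ (r + τ) (by linarith)
    have h7 := hge y τ (r + τ) (by linarith)
    simp only [h1]
    rw [abs_le]
    constructor <;> linarith

/-- Functions `A`, `B` that vanish simultaneously only at `p`, and a cutoff `χ`, such that
`χ * (A - B) / (A + B)` jumps at `p` and does not decrease fast along the flow. -/
lemma exists_jump (hφ : IsFlow φ) (haper : ∀ x : M, ∀ t : ℝ, φ x t = x → t = 0) (p : M) :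
    ∃ A B χ : M → ℝ, Continuous A ∧ Continuous B ∧ Continuous χ ∧ A p = 0 ∧ B p = 0 ∧
      (∀ y, y ≠ p → 0 < A y + B y) ∧ (∀ y, |A y - B y| ≤ A y + B y) ∧
      (∀ y, |χ y| ≤ 1) ∧ χ p ≠ 0 ∧
      ∀ y r, 0 < r → ∀ ρ ρ' : ℝ, |ρ| ≤ 1 → |ρ'| ≤ 1 → ρ * (A y + B y) = A y - B y →
        ρ' * (A (φ y r) + B (φ y r)) = A (φ y r) - B (φ y r) →
        χ y * ρ - χ (φ y r) * ρ' ≤ 4 * r := by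
  obtain ⟨ε, hε, hret⟩ := hφ.exists_no_return haper p
  obtain ⟨χ, hχc, hχ0, hχ1, hχp, hχd, hχl⟩ := hφ.exists_cutoff p hε
  have hA0 := fun y => orbitDist_nonneg φ p y (Icc 0 1)
  have hB0 := fun y => orbitDist_nonneg φ p y (Icc (-1) 0)
  have h01 : (Icc (0 : ℝ) 1).Nonempty := ⟨0, by norm_num⟩
  have h10 : (Icc (-1 : ℝ) 0).Nonempty := ⟨0, by norm_num⟩
  have hpos : ∀ y, y ≠ p → 0 < orbitDist φ p (Icc 0 1) y + orbitDist φ p (Icc (-1) 0) y := by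
    intro y hy
    by_contra! hle
    obtain ⟨s, hs, hseq⟩ := hφ.exists_orbitDist_eq p y isCompact_Icc h01
    obtain ⟨t, ht, hteq⟩ := hφ.exists_orbitDist_eq p y isCompact_Icc h10
    have hs' : φ y s = p := dist_eq_zero.1 (by linarith [hA0 y, hB0 y])
    have ht' : φ y t = p := dist_eq_zero.1 (by linarith [hA0 y, hB0 y])
    have hst : φ (φ y t) (s - t) = φ y t := by
      rw [hφ.2.2, add_sub_cancel, hs', ht']
    have := haper _ _ hst
    have hs0 : s = 0 := by linarith [hs.1, ht.2]
    rw [hs0, hφ.2.1] at hs'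
    exact hy hs'
  refine ⟨orbitDist φ p (Icc 0 1), orbitDist φ p (Icc (-1) 0), χ,
    hφ.continuous_orbitDist p isCompact_Icc, hφ.continuous_orbitDist p isCompact_Icc, hχc,
    ?_, ?_, hpos, ?_, fun y => (abs_of_nonneg (hχ0 y)).trans_le (hχ1 y), hχp.ne', ?_⟩
  · refine le_antisymm ?_ (hA0 p)
    simpa [hφ.2.1] using orbitDist_le φ p p (K := Icc 0 1) (t := 0) (by norm_num)
  · refine le_antisymm ?_ (hB0 p)
    simpa [hφ.2.1] using orbitDist_le φ p p (K := Icc (-1) 0) (t := 0) (by norm_num)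
  · intro y
    rw [abs_le]
    constructor <;> linarith [hA0 y, hB0 y]
  intro y r hr ρ ρ' hρ hρ' heq heq'
  rw [abs_le] at hρ hρ'
  have hlip := abs_le.1 (hχl y r hr.le)
  rcases le_or_gt (1 / 2) r with hr2 | hr2
  · nlinarith [hχ0 y, hχ1 y, hχ0 (φ y r), hχ1 (φ y r)]
  rcases eq_or_ne (χ y) 0 with h0 | h0
  · rw [h0] at hlip ⊢
    nlinarith [hχ0 (φ y r)]
  rcases eq_or_ne (χ (φ y r)) 0 with h0' | h0'
  · rw [h0'] at hlip ⊢
    nlinarith [hχ0 y]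
  have hy := hχd y h0
  have hy' := hχd _ h0'
  have hAA : orbitDist φ p (Icc 0 1) y ≤ orbitDist φ p (Icc 0 1) (φ y r) := by
    refine hφ.orbitDist_le_orbitDist p isCompact_Icc h01 fun t ht => ?_
    rcases le_or_gt (r + t) 1 with h | h
    · exact ⟨r + t, ⟨by linarith [ht.1], h⟩, by rw [hφ.2.2]⟩
    · refine ⟨0, by norm_num, ?_⟩
      rw [hφ.2.1, hφ.2.2]
      have habs : |r + t| = r + t := abs_of_pos (by linarith)
      exact hy.le.trans (hret y hy _ (by linarith) (by linarith [ht.2]))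
  have hBB : orbitDist φ p (Icc (-1) 0) (φ y r) ≤ orbitDist φ p (Icc (-1) 0) y := by
    refine hφ.orbitDist_le_orbitDist p isCompact_Icc h10 fun t ht => ?_
    rcases le_or_gt (-1) (t - r) with h | h
    · exact ⟨t - r, ⟨h, by linarith [ht.2]⟩, by rw [hφ.2.2, add_sub_cancel]⟩
    · refine ⟨0, by norm_num, ?_⟩
      rw [hφ.2.1]
      have habs : |t| = -t := abs_of_neg (by linarith)
      exact hy'.le.trans (hret y hy _ (by linarith) (by linarith [ht.1]))
  have hne : y ≠ p ∨ φ y r ≠ p := by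
    by_contra! h
    exact hr.ne' (haper y r (h.2.trans h.1.symm))
  have := ratio_le_ratio (hA0 y) (hB0 _) hAA hBB (hne.imp (hpos _) (hpos _)) hρ.2 hρ'.1 heq heq'
  nlinarith [hχ0 y, hχ0 (φ y r)]

/-- A minimal time-`c` map of an aperiodic minimal flow has a noninvertible minimal almost
one-to-one extension on the same space: the points `φ p (-n * c)` are blown up to arcs of
the flow. -/
lemma exists_noninvertible_extension (hφ : IsFlow φ) (hmin : ∀ x : M, Dense (range (φ x)))
    (haper : ∀ x : M, ∀ t : ℝ, φ x t = x → t = 0) {c : ℝ} (hc : c ≠ 0)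
    (hmm : IsMinimalMap fun x => φ x c) (p : M) :
    ∃ f : M → M, Continuous f ∧ Function.Surjective f ∧ IsMinimalMap f ∧
      ¬ Function.Injective f ∧
      ∃ π : M → M, IsFactorMap π f (fun x => φ x c) ∧ IsAlmostOneOne π := by
  obtain ⟨A, B, χ, hA, hB, hχ, hAp, hBp, hpos, hAB, hχ1, hχp, hjump⟩ := hφ.exists_jump haper p
  have hdense := hφ.dense_compl_orbit hmin haper p
  have hφc : ∀ t : ℝ, Continuous fun y => φ y t := fun t =>
    hφ.continuous_comp continuous_id continuous_const
  have hcomm : ∀ y s t, φ (φ y s) t = φ (φ y t) s := fun y s t => by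
    rw [hφ.2.2, hφ.2.2, add_comm]
  set S : Set (M × (ℕ → ℝ)) := {z | ∀ n : ℕ, |z.2 n| ≤ 1 ∧
    z.2 n * (A (φ z.1 (n * c)) + B (φ z.1 (n * c))) = A (φ z.1 (n * c)) - B (φ z.1 (n * c))}
    with hS
  have hSc : IsCompact S := by
    have hbig : IsCompact ((univ : Set M) ×ˢ (univ : Set ℕ).pi fun _ => Icc (-1 : ℝ) 1) :=
      isCompact_univ.prod (isCompact_univ_pi fun _ => isCompact_Icc)
    refine hbig.of_isClosed_subset ?_ fun z hz => ⟨mem_univ _, fun n _ => abs_le.1 (hz n).1⟩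
    simp only [hS, ofPred_forall, ofPred_and]
    refine isClosed_iInter fun n => IsClosed.inter ?_ ?_
    · exact isClosed_le (by fun_prop) continuous_const
    · have h1 : Continuous fun z : M × (ℕ → ℝ) => φ z.1 (n * c) := (hφc _).comp continuous_fst
      have h2 := hA.comp h1
      have h3 := hB.comp h1
      have h4 : Continuous fun z : M × (ℕ → ℝ) => z.2 n := by fun_prop
      exact isClosed_eq (h4.mul (h2.add h3)) (h2.sub h3)
  have : CompactSpace S := isCompact_iff_compactSpace.1 hSc
  -- the displacement along the flow of a point of `S`
  set term : ℕ → S → ℝ := fun n z => (1 / 2 : ℝ) ^ n / 16 * (χ (φ z.1.1 (n * c)) * z.1.2 n)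
    with hterm
  have hgeo : HasSum (fun n : ℕ => (1 / 2 : ℝ) ^ n / 16) (1 / 8) := by
    have h := hasSum_geometric_two.div_const 16
    rwa [show (2 : ℝ) / 16 = 1 / 8 by norm_num] at h
  have hbound : ∀ n z, ‖term n z‖ ≤ (1 / 2 : ℝ) ^ n / 16 := by
    intro n z
    have h1 : |χ (φ z.1.1 (n * c)) * z.1.2 n| ≤ 1 := by
      rw [abs_mul]
      exact mul_le_one₀ (hχ1 _) (abs_nonneg _) (z.2 n).1
    rw [hterm, Real.norm_eq_abs, abs_mul, abs_of_pos (by positivity)]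
    exact mul_le_of_le_one_right (by positivity) h1
  have hsum : ∀ z, Summable fun n => term n z := fun z =>
    Summable.of_norm_bounded hgeo.summable fun n => hbound n z
  set b : S → ℝ := fun z => ∑' n, term n z with hb
  have hbc : Continuous b := by
    refine continuous_tsum (fun n => ?_) hgeo.summable hbound
    have h1 : Continuous fun z : S => χ (φ z.1.1 (n * c)) :=
      hχ.comp ((hφc _).comp (by fun_prop))
    exact continuous_const.mul (h1.mul (by fun_prop))
  have hb1 : ∀ z, |b z| ≤ 1 / 8 := fun z =>
    tsum_of_norm_bounded hgeo fun n => hbound n z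
  have hslope : ∀ z z' : S, ∀ r, 0 < r → z'.1.1 = φ z.1.1 r → b z - b z' ≤ r / 2 := by
    intro z z' r hr hz
    rw [hb, ← (hsum z).tsum_sub (hsum z')]
    have hr2 : HasSum (fun n : ℕ => (1 / 2 : ℝ) ^ n / 16 * (4 * r)) (r / 2) := by
      have h := hgeo.mul_right (4 * r)
      rwa [show 1 / 8 * (4 * r) = r / 2 by ring] at h
    refine (((hsum z).sub (hsum z')).tsum_le_tsum (fun n => ?_) hr2.summable).trans_eq hr2.tsum_eq
    have h1 := (z'.2 n)
    rw [hz, hcomm] at h1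
    have h2 := hjump _ r hr _ _ (z.2 n).1 h1.1 (z.2 n).2 h1.2
    simp only [hterm, hz, ← mul_sub, hcomm z.1.1 r]
    exact mul_le_mul_of_nonneg_left h2 (by positivity)
  -- a section of the first projection
  set R : M → ℝ := fun y => (A y - B y) / (A y + B y) with hR
  have hRmem : ∀ y, |R y| ≤ 1 ∧ R y * (A y + B y) = A y - B y := by
    intro y
    rcases eq_or_ne y p with rfl | hy
    · simp [hR, hAp, hBp]
    · refine ⟨?_, div_mul_cancel₀ _ (hpos y hy).ne'⟩
      rw [hR, abs_div, abs_of_pos (hpos y hy)]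
      exact div_le_one_of_le₀ (hAB y) (hpos y hy).le
  have hRuniq : ∀ y, y ≠ p → ∀ v v', v * (A y + B y) = A y - B y →
      v' * (A y + B y) = A y - B y → v = v' := fun y hy v v' hv hv' =>
    mul_right_cancel₀ (hpos y hy).ne' (hv.trans hv'.symm)
  set σ : M → S := fun y => ⟨(y, fun n => R (φ y (n * c))), fun n => hRmem _⟩ with hσ
  have horb : ∀ y, y ∉ range (φ p) → ∀ t, φ y t ≠ p := by
    rintro y hy t rfl
    exact hy ⟨-t, by rw [hφ.2.2, add_neg_cancel, hφ.2.1]⟩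
  have horb' : ∀ y, y ∉ range (φ p) → ∀ t, φ y t ∉ range (φ p) := by
    rintro y hy t ⟨s, hs⟩
    refine horb y hy (t - s) ?_
    rw [sub_eq_add_neg, ← hφ.2.2, ← hs, hφ.2.2, add_neg_cancel, hφ.2.1]
  have hσuniq : ∀ z : S, z.1.1 ∉ range (φ p) → z = σ z.1.1 := fun z hz =>
    Subtype.ext (Prod.ext rfl (funext fun n =>
      hRuniq _ (horb _ hz _) _ _ (z.2 n).2 (hRmem _).2))
  -- the homeomorphism between `S` and `M`
  set Q : S → M := fun z => φ z.1.1 (b z) with hQ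
  have hQc : Continuous Q := hφ.continuous_comp (by fun_prop) hbc
  have hQinj : Function.Injective Q := by
    have hback : ∀ z z' : S, Q z = Q z' → z'.1.1 = φ z.1.1 (b z - b z') := by
      intro z z' h
      rw [sub_eq_add_neg, ← hφ.2.2]
      change _ = φ (Q z) _
      rw [h, hQ, hφ.2.2, add_neg_cancel, hφ.2.1]
    intro z z' h
    have h1 : b z = b z' := by
      rcases lt_trichotomy (b z) (b z') with hlt | heq | hlt
      · have := hslope z' z _ (sub_pos.2 hlt) (hback z' z h.symm)
        linarith
      · exact heq
      · have := hslope z z' _ (sub_pos.2 hlt) (hback z z' h)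
        linarith
    have h2 : z'.1.1 = z.1.1 := by
      rw [hback z z' h, h1, sub_self, hφ.2.1]
    have h3 : ∀ n : ℕ, φ z.1.1 (n * c) ≠ p → z.1.2 n = z'.1.2 n := by
      intro n hn
      have := (z'.2 n).2
      rw [h2] at this
      exact hRuniq _ hn _ _ (z.2 n).2 this
    refine Subtype.ext (Prod.ext h2.symm (funext fun n => ?_))
    by_cases hn : φ z.1.1 (n * c) = p
    · have hzero : ∀ m, m ≠ n → term m z - term m z' = 0 := by
        intro m hm
        have : φ z.1.1 (m * c) ≠ p := by
          intro hmp
          have h4 : φ (φ z.1.1 (n * c)) (m * c - n * c) = φ z.1.1 (n * c) := by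
            rw [hφ.2.2, add_sub_cancel, hmp, hn]
          have h5 := haper _ _ h4
          rw [← sub_mul, mul_eq_zero, or_iff_left hc, sub_eq_zero] at h5
          exact hm (by exact_mod_cast h5)
        simp only [hterm, h2, h3 m this, sub_self]
      have h4 : ∑' m, (term m z - term m z') = 0 := by
        rw [(hsum z).tsum_sub (hsum z')]
        exact sub_eq_zero.2 h1
      rw [tsum_eq_single n hzero] at h4
      simp only [hterm, h2, hn, ← mul_sub] at h4
      have h5 : (1 / 2 : ℝ) ^ n / 16 ≠ 0 := by positivity
      exact sub_eq_zero.1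
        ((mul_eq_zero.1 ((mul_eq_zero.1 h4).resolve_left h5)).resolve_left hχp)
    · exact h3 n hn
  have hQsurj : Function.Surjective Q := by
    rw [← range_eq_univ]
    have hcl : IsClosed (range Q) := (isCompact_range hQc).isClosed
    rw [← hcl.closure_eq]
    refine (hdense.mono fun x hx => ?_).closure_eq
    have hflowc : ∀ s : ℝ, Continuous fun t : ℝ => φ (φ x (-t)) s := fun s =>
      (hφc s).comp (hφ.continuous_comp continuous_const continuous_neg)
    have hσc : Continuous fun t : ℝ => σ (φ x (-t)) := by
      refine Continuous.subtype_mk (Continuous.prodMk ?_ (continuous_pi fun n => ?_)) _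
      · exact hφ.continuous_comp continuous_const continuous_neg
      · have h1 := hA.comp (hflowc (n * c))
        have h2 := hB.comp (hflowc (n * c))
        exact (h1.sub h2).div (h1.add h2) fun t =>
          (hpos _ (horb _ (horb' x hx _) _)).ne'
    have hg : Continuous fun t : ℝ => t - b (σ (φ x (-t))) := continuous_id.sub (hbc.comp hσc)
    have hbt : ∀ t, |b (σ (φ x (-t)))| ≤ 1 := fun t => (hb1 _).trans (by norm_num)
    obtain ⟨t, -, ht⟩ := intermediate_value_Icc (show (-1 : ℝ) ≤ 1 by norm_num) hg.continuousOn
      (show (0 : ℝ) ∈ Icc _ _ from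
        ⟨sub_nonpos.2 (abs_le.1 (hbt (-1))).1, sub_nonneg.2 (abs_le.1 (hbt 1)).2⟩)
    refine ⟨σ (φ x (-t)), ?_⟩
    change φ (φ x (-t)) (b (σ (φ x (-t)))) = x
    rw [← sub_eq_zero.1 ht, hφ.2.2, neg_add_cancel, hφ.2.1]
  set e : S ≃ₜ M :=
    Continuous.homeoOfEquivCompactToT2 (f := Equiv.ofBijective Q ⟨hQinj, hQsurj⟩) hQc with he
  have heQ : ∀ z, e z = φ z.1.1 (b z) := fun z => rfl
  -- the shift on `S`
  have hshift : ∀ y (n : ℕ), φ (φ y c) (n * c) = φ y ((n + 1 : ℕ) * c) := by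
    intro y n
    rw [hφ.2.2]
    push_cast
    ring_nf
  set F : S → S := fun z => ⟨(φ z.1.1 c, fun n => z.1.2 (n + 1)), fun n => by
    simpa only [hshift] using z.2 (n + 1)⟩ with hF
  have hFc : Continuous F := by
    refine Continuous.subtype_mk (Continuous.prodMk ?_ (continuous_pi fun n => ?_)) _
    · exact (hφc c).comp (by fun_prop)
    · fun_prop
  have hcons : ∀ (z' : S) (y : M) (v : ℝ), φ y c = z'.1.1 → |v| ≤ 1 →
      v * (A y + B y) = A y - B y → ∃ z : S, F z = z' ∧ z.1.2 0 = v := by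
    intro z' y v hy hv1 hv
    refine ⟨⟨(y, fun n => Nat.casesOn n v z'.1.2), fun n => ?_⟩,
      Subtype.ext (Prod.ext hy rfl), rfl⟩
    cases n with
    | zero => simpa [hφ.2.1] using ⟨hv1, hv⟩
    | succ n => simpa only [← hshift, hy] using z'.2 n
  have hFsurj : Function.Surjective F := by
    intro z'
    obtain ⟨z, hz, -⟩ := hcons z' (φ z'.1.1 (-c)) _
      (by rw [hφ.2.2, neg_add_cancel, hφ.2.1]) (hRmem _).1 (hRmem _).2
    exact ⟨z, hz⟩
  have hFninj : ¬ Function.Injective F := by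
    intro hinj
    obtain ⟨z₁, h₁, h₁'⟩ := hcons (σ (φ p c)) p 1 rfl (by norm_num) (by simp [hAp, hBp])
    obtain ⟨z₂, h₂, h₂'⟩ := hcons (σ (φ p c)) p (-1) rfl (by norm_num) (by simp [hAp, hBp])
    rw [hinj (h₁.trans h₂.symm), h₂'] at h₁'
    norm_num at h₁'
  set f : M → M := fun x => e (F (e.symm x)) with hf
  set π : M → M := fun x => (e.symm x).1.1 with hπ
  have hfc : Continuous f := e.continuous.comp (hFc.comp e.symm.continuous)
  have hπc : Continuous π := continuous_fst.comp (continuous_subtype_val.comp e.symm.continuous)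
  have hsemi : Function.Semiconj π f fun x => φ x c := fun x => by
    simp only [hπ, hf, e.symm_apply_apply, hF]
  have hπorb : ∀ x, π x ∈ range (φ p) → x ∈ range (φ p) := by
    rintro x ⟨t, ht⟩
    refine ⟨t + b (e.symm x), ?_⟩
    rw [← hφ.2.2, ht, ← heQ, e.apply_symm_apply]
  have hfib : ∀ x x', π x ∉ range (φ p) → π x = π x' → x = x' := by
    intro x x' hx hxx
    refine e.symm.injective ?_
    rw [hσuniq _ hx, hσuniq (e.symm x') (show π x' ∉ _ from hxx ▸ hx)]
    exact congrArg σ hxx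
  refine ⟨f, hfc, e.surjective.comp (hFsurj.comp e.symm.surjective), ⟨hfc, fun x => ?_⟩,
    fun hinj => hFninj fun z z' h => ?_, π, ⟨hπc, fun y => ⟨e (σ y), ?_⟩, hsemi.comp_eq⟩, ?_⟩
  · set K := closure (range fun n : ℕ => f^[n + 1] x) with hK
    have hπK : π '' K = univ := by
      have hcl : IsClosed (π '' K) := (isClosed_closure.isCompact.image hπc).isClosed
      rw [← hcl.closure_eq]
      refine ((hmm.2 (π x)).mono ?_).closure_eq
      rintro _ ⟨n, rfl⟩
      exact ⟨_, subset_closure ⟨n, rfl⟩, hsemi.iterate_right (n + 1) x⟩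
    rw [← dense_closure]
    refine hdense.mono fun y hy => ?_
    obtain ⟨k, hk, hky⟩ : π y ∈ π '' K := hπK ▸ mem_univ _
    rwa [hfib y k (fun h => hy (hπorb y h)) hky.symm]
  · refine e.injective (hinj ?_)
    simp only [hf, e.symm_apply_apply, h]
  · simp only [hπ, e.symm_apply_apply, hσ]
  · refine hdense.mono fun y hy => ⟨e (σ y), ?_, fun x hx => ?_⟩
    · simp only [hπ, e.symm_apply_apply, hσ]
    · refine hfib x _ (by rwa [hx]) (hx.trans ?_)
      simp only [hπ, e.symm_apply_apply, hσ]

end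

end IsFlow

/-- For a continuous aperiodic minimal flow on a compact finite–dimensional metric
space, a residual set of times `c` is such that the time-`c` map admits a noninvertible
minimal map as an almost 1-1 extension. -/
theorem stmt3 {M : Type*} [MetricSpace M] [CompactSpace M] [Nonempty M]
    (hemb : ∃ (d : ℕ) (e : M → (Fin d → ℝ)), IsEmbedding e)
    (φ : M → ℝ → M) (hflow : IsFlow φ)
    (hmin : ∀ x : M, Dense (Set.range (φ x)))
    (haper : ∀ x : M, ∀ t : ℝ, φ x t = x → t = 0) :
    ∃ A : Set ℝ, A ∈ residual ℝ ∧ ∀ c ∈ A,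
      ∃ f : M → M, Continuous f ∧ Function.Surjective f ∧ IsMinimalMap f ∧
        ¬ Function.Injective f ∧
        ∃ π : M → M, IsFactorMap π f (fun x => φ x c) ∧ IsAlmostOneOne π := by
  let p : M := Classical.arbitrary M
  refine ⟨_, hflow.residual_dense_time_orbit hmin p, fun c hc => ?_⟩
  exact hflow.exists_noninvertible_extension hmin haper hc.1
    (hflow.isMinimalMap_time hmin hc.1 hc.2) p
end
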